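/- If κ is the least supercompact cardinal that is a limit of supercompact cardinals, then there is a partial function ℓ : κ ⇀ V_κ such that ℓ↾δ is a LD^sc_δ Laver function for every supercompact cardinal δ < κ, but ℓ is not a LD^sc_κ Laver function. -/

import Mathlib

open FirstOrder

universe u

namespace LaverDiamond

/-- The relation symbols of the language of set theory: a single binary relation `mem`. -/
inductive memRel : ℕ → Type
  | mem : memRel 2

/-- The first-order language of set theory. -/
def SetLang : FirstOrder.Language := ⟨fun _ => Empty, memRel⟩

/-- Any class of ZF-sets is a structure in the language of set theory, with the true
membership relation. -/
instance classStructure (M : Set ZFSet.{u}) : SetLang.Structure M where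
  funMap := fun {_} f _ => f.elim
  RelMap := fun {_} r x => match r with
    | .mem => (x 0 : ZFSet) ∈ (x 1 : ZFSet)

/-- A (fully) elementary embedding from the class `M` to the class `N`, both classes of
ZF-sets equipped with the true membership relation.  It is coded by a global function
`j : ZFSet → ZFSet` mapping `M` into `N`, elementary for all first-order formulas
with parameters from `M`. -/
structure ClassEmb (M N : Set ZFSet.{u}) where
  j : ZFSet.{u} → ZFSet.{u}
  maps : ∀ x, x ∈ M → j x ∈ N
  elem : ∀ {n : ℕ} (φ : SetLang.Formula (Fin n)) (v : Fin n → ZFSet.{u}) (hv : ∀ i, v i ∈ M),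
    φ.Realize (fun i => (⟨v i, hv i⟩ : M)) ↔ φ.Realize (fun i => (⟨j (v i), maps _ (hv i)⟩ : N))

/-- The universe of all ZF-sets, as a class. -/
def V : Set ZFSet.{u} := Set.univ

/-- A transitive class of ZF-sets. -/
def TransClass (M : Set ZFSet.{u}) : Prop := ∀ x ∈ M, ∀ y ∈ x, y ∈ M

/-- `j` has critical point `κ`: `κ` is an ordinal, fixed below `κ`, with `j(κ) > κ`. -/
def CritPt (j : ZFSet.{u} → ZFSet.{u}) (κ : ZFSet.{u}) : Prop :=
  κ.IsOrdinal ∧ κ ∈ j κ ∧ ∀ α : ZFSet, α.IsOrdinal → α ∈ κ → j α = α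

/-- `x` is a member of the rank-initial segment `V_θ`. -/
def MemV (θ x : ZFSet.{u}) : Prop := x.rank < θ.rank

/-- `κ` is a cardinal: an ordinal not equinumerous with any smaller ordinal. -/
def IsCard (κ : ZFSet.{u}) : Prop :=
  κ.IsOrdinal ∧ ∀ β ∈ κ, Cardinal.mk β.toSet < Cardinal.mk κ.toSet

/-- `x ∈ H(θ⁺)`, i.e. `x` has hereditary size at most `θ`. -/
def MemH (θ x : ZFSet.{u}) : Prop :=
  ∃ t : ZFSet, t.IsTransitive ∧ x ∈ t ∧ Cardinal.mk t.toSet ≤ Cardinal.mk θ.toSet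

/-- `f` is a set-function with domain `θ` taking values in the class `M`. -/
def IsFuncInto (θ : ZFSet.{u}) (M : Set ZFSet.{u}) (f : ZFSet.{u}) : Prop :=
  (∀ p ∈ f, ∃ a b : ZFSet, a ∈ θ ∧ b ∈ M ∧ p = ZFSet.pair a b) ∧
  ∀ a ∈ θ, ∃! b : ZFSet, ZFSet.pair a b ∈ f

/-- The class `M` is closed under `θ`-sequences: `M^θ ⊆ M`. -/
def SeqClosed (θ : ZFSet.{u}) (M : Set ZFSet.{u}) : Prop :=
  ∀ f : ZFSet, IsFuncInto θ M f → f ∈ M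

/-- The set `M` is closed under `<κ`-sequences: `M^{<κ} ⊆ M`. -/
def SeqClosedLt (κ M : ZFSet.{u}) : Prop :=
  ∀ α : ZFSet, α ∈ κ → ∀ f : ZFSet, IsFuncInto α M.toSet f → f ∈ M

/-- `ℓ` is a partial function from `κ` to `V_κ` (coded as a set of Kuratowski pairs). -/
def IsPFun (κ ℓ : ZFSet.{u}) : Prop :=
  (∀ p ∈ ℓ, ∃ γ A : ZFSet, γ ∈ κ ∧ MemV κ A ∧ p = ZFSet.pair γ A) ∧
  ∀ γ A B : ZFSet, ZFSet.pair γ A ∈ ℓ → ZFSet.pair γ B ∈ ℓ → A = B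

/-- The set `r` is the restriction to `κ` of the class function `ℓ` (defined on the
ordinals below `κ`), coded as a set of Kuratowski pairs. -/
def RestrictEq (ℓ : ZFSet.{u} → ZFSet.{u}) (κ r : ZFSet.{u}) : Prop :=
  ∀ p : ZFSet, p ∈ r ↔ ∃ γ : ZFSet, γ ∈ κ ∧ p = ZFSet.pair γ (ℓ γ)

/-- The set `r` is the restriction to `κ` of the class function `ℓ` restricted further to
the class `D`. -/
def RestrictEqOn (ℓ : ZFSet.{u} → ZFSet.{u}) (D : Set ZFSet.{u}) (κ r : ZFSet.{u}) : Prop :=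
  ∀ p : ZFSet, p ∈ r ↔ ∃ γ : ZFSet, γ ∈ κ ∧ γ ∈ D ∧ p = ZFSet.pair γ (ℓ γ)

/-- The set `r` is the restriction to `δ` of the set partial function `ℓ`. -/
def RestrictSet (ℓ δ r : ZFSet.{u}) : Prop :=
  ∀ p : ZFSet, p ∈ r ↔ p ∈ ℓ ∧ ∃ γ A : ZFSet, γ ∈ δ ∧ p = ZFSet.pair γ A

/-! ### Supercompactness -/

/-- A `θ`-supercompactness embedding with critical point `κ`: an elementary embedding
`j : V → M` with `M` a transitive class closed under `θ`-sequences and `j(κ) > θ`. -/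
structure SCEmb (κ θ : ZFSet.{u}) where
  M : Set ZFSet.{u}
  trans : TransClass M
  e : ClassEmb V M
  crit : CritPt e.j κ
  closed : SeqClosed θ M
  big : θ ∈ e.j κ

/-- `κ` is `θ`-supercompact. -/
def SCAt (κ θ : ZFSet.{u}) : Prop := Nonempty (SCEmb κ θ)

/-- `κ` is supercompact: `θ`-supercompact for every cardinal `θ`. -/
def Supercompact (κ : ZFSet.{u}) : Prop := ∀ θ : ZFSet, IsCard θ → SCAt κ θ

/-- `ℓ` is a Laver function witnessing the Laver diamond `LD^sc_κ`. -/
def LDscFun (κ ℓ : ZFSet.{u}) : Prop :=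
  IsPFun κ ℓ ∧ ∀ θ A : ZFSet, IsCard θ → MemH θ A →
    ∃ E : SCEmb κ θ, ZFSet.pair κ A ∈ E.e.j ℓ

/-- The Laver diamond principle `LD^sc_κ`. -/
def LDsc (κ : ZFSet.{u}) : Prop := ∃ ℓ : ZFSet, LDscFun κ ℓ

/-- A universal `LD^sc` Laver function. -/
def UnivLDsc (ℓ : ZFSet.{u} → ZFSet.{u}) : Prop :=
  ∀ κ : ZFSet, Supercompact κ → ∃ r : ZFSet, RestrictEq ℓ κ r ∧ LDscFun κ r

/-! ### Strongness -/

/-- A `θ`-strongness embedding with critical point `κ`: an elementary `j : V → M` with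
`M` a transitive class and `V_θ ⊆ M`. -/
structure StrEmb (κ θ : ZFSet.{u}) where
  M : Set ZFSet.{u}
  trans : TransClass M
  e : ClassEmb V M
  crit : CritPt e.j κ
  vsub : ∀ x : ZFSet, MemV θ x → x ∈ M

/-- `κ` is `θ`-strong. -/
def StrongAt (κ θ : ZFSet.{u}) : Prop := Nonempty (StrEmb κ θ)

/-- `κ` is a strong cardinal. -/
def Strong (κ : ZFSet.{u}) : Prop := ∀ θ : ZFSet, θ.IsOrdinal → StrongAt κ θ

/-- `ℓ` witnesses the Laver diamond `LD^strong_κ`. -/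
def LDstrongFun (κ ℓ : ZFSet.{u}) : Prop :=
  IsPFun κ ℓ ∧ ∀ θ A : ZFSet, θ.IsOrdinal → MemV θ A →
    ∃ E : StrEmb κ θ, ZFSet.pair κ A ∈ E.e.j ℓ

/-- The Laver diamond principle `LD^strong_κ`. -/
def LDstrong (κ : ZFSet.{u}) : Prop := ∃ ℓ : ZFSet, LDstrongFun κ ℓ

/-- A universal `LD^strong` Laver function. -/
def UnivLDstrong (ℓ : ZFSet.{u} → ZFSet.{u}) : Prop :=
  ∀ κ : ZFSet, Strong κ → ∃ r : ZFSet, RestrictEq ℓ κ r ∧ LDstrongFun κ r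

/-! ### Measurability -/

/-- An embedding witnessing measurability of `κ`: an elementary `j : V → M`
with `M` a transitive class and critical point `κ`. -/
structure MeasEmb (κ : ZFSet.{u}) where
  M : Set ZFSet.{u}
  trans : TransClass M
  e : ClassEmb V M
  crit : CritPt e.j κ

/-- `κ` is a measurable cardinal. -/
def MeasurableCard (κ : ZFSet.{u}) : Prop := Nonempty (MeasEmb κ)

/-- `ℓ` witnesses the Laver diamond `LD^meas_κ`. -/
def LDmeasFun (κ ℓ : ZFSet.{u}) : Prop :=
  IsPFun κ ℓ ∧ ∀ A : ZFSet, MemH κ A → ∃ E : MeasEmb κ, ZFSet.pair κ A ∈ E.e.j ℓ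

/-- The Laver diamond principle `LD^meas_κ`. -/
def LDmeas (κ : ZFSet.{u}) : Prop := ∃ ℓ : ZFSet, LDmeasFun κ ℓ

/-- A universal `LD^meas` Laver function. -/
def UnivLDmeas (ℓ : ZFSet.{u} → ZFSet.{u}) : Prop :=
  ∀ κ : ZFSet, MeasurableCard κ → ∃ r : ZFSet, RestrictEq ℓ κ r ∧ LDmeasFun κ r

/-! ### Weak compactness -/

/-- `κ` is weakly compact: every transitive set `M` of size `κ` with `κ ∈ M` admits an
elementary embedding `j : M → N` into a transitive set `N` with critical point `κ`. -/
def WeaklyCompact (κ : ZFSet.{u}) : Prop :=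
  ∀ M : ZFSet, M.IsTransitive → Cardinal.mk M.toSet = Cardinal.mk κ.toSet → κ ∈ M →
    ∃ N : ZFSet, N.IsTransitive ∧ ∃ e : ClassEmb M.toSet N.toSet, CritPt e.j κ

/-- `ℓ` witnesses the Laver diamond `LD^wc_κ`. -/
def LDwcFun (κ ℓ : ZFSet.{u}) : Prop :=
  IsPFun κ ℓ ∧ ∀ A M : ZFSet, MemH κ A →
    M.IsTransitive → Cardinal.mk M.toSet = Cardinal.mk κ.toSet → κ ∈ M → A ∈ M → ℓ ∈ M →
    ∃ N : ZFSet, N.IsTransitive ∧ ∃ e : ClassEmb M.toSet N.toSet,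
      CritPt e.j κ ∧ ZFSet.pair κ A ∈ e.j ℓ

/-- The Laver diamond principle `LD^wc_κ`. -/
def LDwc (κ : ZFSet.{u}) : Prop := ∃ ℓ : ZFSet, LDwcFun κ ℓ

/-- A universal `LD^wc` Laver function. -/
def UnivLDwc (ℓ : ZFSet.{u} → ZFSet.{u}) : Prop :=
  ∀ κ : ZFSet, WeaklyCompact κ → ∃ r : ZFSet, RestrictEq ℓ κ r ∧ LDwcFun κ r

/-! ### Nice structures and unfoldability -/

/-- `M` is a nice structure for `κ`: a transitive set of size `κ`, closed under
`<κ`-sequences, with `κ ∈ M`. -/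
def Nice (κ M : ZFSet.{u}) : Prop :=
  M.IsTransitive ∧ Cardinal.mk M.toSet = Cardinal.mk κ.toSet ∧ SeqClosedLt κ M ∧ κ ∈ M

/-- `κ` is unfoldable: for every ordinal `θ`, every nice structure admits a
`θ`-unfoldability embedding. -/
def Unfoldable (κ : ZFSet.{u}) : Prop :=
  ∀ θ M : ZFSet, θ.IsOrdinal → Nice κ M →
    ∃ N : ZFSet, N.IsTransitive ∧ ∃ e : ClassEmb M.toSet N.toSet, CritPt e.j κ ∧ θ ∈ e.j κ

/-- `ℓ` witnesses the Laver diamond `LD^unf_κ`. -/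
def LDunfFun (κ ℓ : ZFSet.{u}) : Prop :=
  IsPFun κ ℓ ∧ ∀ θ A M : ZFSet, θ.IsOrdinal → MemH κ A →
    M.IsTransitive → Cardinal.mk M.toSet = Cardinal.mk κ.toSet → SeqClosedLt κ M →
    κ ∈ M → ℓ ∈ M → A ∈ M →
    ∃ N : ZFSet, N.IsTransitive ∧ ∃ e : ClassEmb M.toSet N.toSet,
      CritPt e.j κ ∧ θ ∈ e.j κ ∧ ZFSet.pair κ A ∈ e.j ℓ

/-- The Laver diamond principle `LD^unf_κ`. -/
def LDunf (κ : ZFSet.{u}) : Prop := ∃ ℓ : ZFSet, LDunfFun κ ℓ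

/-- `ℓ` witnesses the Laver diamond `LD^sunf_κ` for strong unfoldability. -/
def LDsunfFun (κ ℓ : ZFSet.{u}) : Prop :=
  IsPFun κ ℓ ∧ ∀ θ A M : ZFSet, IsCard θ → MemH θ A →
    M.IsTransitive → Cardinal.mk M.toSet = Cardinal.mk κ.toSet → SeqClosedLt κ M →
    κ ∈ M → ℓ ∈ M →
    ∃ N : ZFSet, N.IsTransitive ∧ (∀ x : ZFSet, MemV θ x → x ∈ N) ∧
      ∃ e : ClassEmb M.toSet N.toSet, CritPt e.j κ ∧ θ ∈ e.j κ ∧ ZFSet.pair κ A ∈ e.j ℓ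

/-! ### Ramsey cardinals -/

/-- `F` is a weakly amenable `M`-normal measure on `κ`. -/
def MNormalMeasure (κ M F : ZFSet.{u}) : Prop :=
  (∀ X ∈ F, X ⊆ κ ∧ X ∈ M) ∧ κ ∈ F ∧ (∅ : ZFSet) ∉ F ∧
  (∀ X Y : ZFSet, X ∈ F → Y ∈ F → X ∩ Y ∈ F) ∧
  (∀ X Y : ZFSet, X ∈ F → Y ∈ M → X ⊆ Y → Y ⊆ κ → Y ∈ F) ∧
  (∀ X : ZFSet, X ∈ M → X ⊆ κ → (X ∈ F ∨ κ \ X ∈ F)) ∧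
  (∀ ξ ∈ κ, ({ξ} : ZFSet) ∉ F) ∧
  (∀ γ f : ZFSet, γ ∈ κ → f ∈ M → IsFuncInto γ F.toSet f →
    ZFSet.sep (fun ξ => ∀ a X : ZFSet, ZFSet.pair a X ∈ f → ξ ∈ X) κ ∈ F) ∧
  (∀ f : ZFSet, f ∈ M → IsFuncInto κ F.toSet f →
    ZFSet.sep (fun ξ => ∀ a X : ZFSet, ZFSet.pair a X ∈ f → a ∈ ξ → ξ ∈ X) κ ∈ F) ∧
  (∀ D : ZFSet, D ∈ M → MemH κ D → F ∩ D ∈ M)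

/-- `j` is (isomorphic to) the ultrapower map of `M` by the `M`-measure `F` on `κ`, with
transitive (wellfounded) target `N`: `j` is elementary, has critical point `κ`, derives the
measure `F` at `κ`, and every element of `N` has the form `j(f)(κ)` for some function
`f ∈ M` with domain `κ`. -/
def IsUltrapowerMap (κ M F N : ZFSet.{u}) (j : ZFSet.{u} → ZFSet.{u}) : Prop :=
  N.IsTransitive ∧ (∃ e : ClassEmb M.toSet N.toSet, e.j = j) ∧ CritPt j κ ∧
  (∀ X : ZFSet, X ∈ M → X ⊆ κ → (X ∈ F ↔ κ ∈ j X)) ∧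
  (∀ y ∈ N, ∃ f : ZFSet, f ∈ M ∧ (∀ a ∈ κ, ∃! b : ZFSet, ZFSet.pair a b ∈ f) ∧
    ZFSet.pair κ y ∈ j f)

/-- A wellfounded iteration of `⟨M, F⟩` of length `δ`: a commuting system of elementary
embeddings between transitive models, starting at `⟨M, F⟩`, taking ultrapowers by the
image measures at successor steps and direct limits at limit stages. -/
structure Iteration (κ M F δ : ZFSet.{u}) where
  Mod : ZFSet.{u} → ZFSet.{u}
  Meas : ZFSet.{u} → ZFSet.{u}
  cp : ZFSet.{u} → ZFSet.{u}
  emb : ZFSet.{u} → ZFSet.{u} → ZFSet.{u} → ZFSet.{u}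
  mod_zero : Mod ∅ = M
  meas_zero : Meas ∅ = F
  cp_zero : cp ∅ = κ
  trans' : ∀ i : ZFSet, i ∈ δ → (Mod i).IsTransitive
  elem' : ∀ i k : ZFSet, i ∈ δ → k ∈ δ → i ∈ k →
    ∃ e : ClassEmb (Mod i).toSet (Mod k).toSet, e.j = emb i k
  comm : ∀ i k l : ZFSet, i ∈ δ → k ∈ δ → l ∈ δ → i ∈ k → k ∈ l →
    ∀ x ∈ Mod i, emb k l (emb i k x) = emb i l x
  cp_emb : ∀ i : ZFSet, i ∈ δ → i ≠ ∅ → cp i = emb ∅ i κ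
  succ' : ∀ i : ZFSet, i ∈ δ → insert i i ∈ δ →
    IsUltrapowerMap (cp i) (Mod i) (Meas i) (Mod (insert i i)) (emb i (insert i i)) ∧
    (∀ Y : ZFSet, Y ∈ Meas (insert i i) ↔
      ∃ D : ZFSet, D ∈ Mod i ∧ Y ∈ emb i (insert i i) (Meas i ∩ D))
  limit' : ∀ l : ZFSet, l ∈ δ → l ≠ ∅ → (∀ i ∈ l, insert i i ∈ l) →
    (∀ y ∈ Mod l, ∃ i : ZFSet, i ∈ l ∧ ∃ x, x ∈ Mod i ∧ emb i l x = y) ∧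
    (∀ Y : ZFSet, Y ∈ Meas l ↔
      ∃ i : ZFSet, i ∈ l ∧ ∃ D, D ∈ Mod i ∧ Y ∈ emb i l (Meas i ∩ D))

/-- `⟨M, F⟩` is iterable: all its iterations (of any ordinal length) are wellfounded,
i.e. realized by transitive models. -/
def Iterable (κ M F : ZFSet.{u}) : Prop :=
  ∀ δ : ZFSet, δ.IsOrdinal → Nonempty (Iteration κ M F δ)

/-! ### Constructibility -/

/-- `X` is a subset of `M` definable over `⟨M, ∈⟩` with parameters. -/
def DefinableSubset (M X : ZFSet.{u}) : Prop :=
  X ⊆ M ∧ ∃ (n : ℕ) (φ : SetLang.Formula (Fin (n + 1))) (v : Fin n → ZFSet.{u})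
    (hv : ∀ i, v i ∈ M.toSet),
    ∀ a : ZFSet, a ∈ X ↔ ∃ ha : a ∈ M.toSet,
      φ.Realize (Fin.cons (⟨a, ha⟩ : M.toSet) (fun i => (⟨v i, hv i⟩ : M.toSet)))

/-- The set of all subsets of `M` definable over `⟨M, ∈⟩` with parameters. -/
noncomputable def DefSet (M : ZFSet.{u}) : ZFSet.{u} :=
  ZFSet.sep (fun X => DefinableSubset M X) (ZFSet.powerset M)

/-- `h` codes the constructible hierarchy up to `δ`: a function with domain `δ` such that
`h(β) = ⋃_{γ<β} Def(h(γ))` for every `β < δ`. -/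
def IsLHierarchy (δ h : ZFSet.{u}) : Prop :=
  δ.IsOrdinal ∧
  (∀ p ∈ h, ∃ β y : ZFSet, β ∈ δ ∧ p = ZFSet.pair β y) ∧
  (∀ β ∈ δ, ∃! y : ZFSet, ZFSet.pair β y ∈ h) ∧
  ∀ β y : ZFSet, ZFSet.pair β y ∈ h →
    ∀ z : ZFSet, z ∈ y ↔ ∃ γ x : ZFSet, γ ∈ β ∧ ZFSet.pair γ x ∈ h ∧ z ∈ DefSet x

/-- `x` is constructible: it appears at some level of some constructible hierarchy. -/
def Constructible (x : ZFSet.{u}) : Prop :=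
  ∃ δ h β y : ZFSet, IsLHierarchy δ h ∧ ZFSet.pair β y ∈ h ∧ x ∈ y

/-- The axiom of constructibility `V = L`. -/
def VeqL : Prop := ∀ x : ZFSet.{u}, Constructible x

/-! ### Normal measures -/

/-- `U` is a normal measure on `κ`: a `κ`-complete nonprincipal ultrafilter on `κ`
closed under diagonal intersections. -/
def IsNormalMeasure (κ U : ZFSet.{u}) : Prop :=
  (∀ X ∈ U, X ⊆ κ) ∧ κ ∈ U ∧ (∅ : ZFSet) ∉ U ∧
  (∀ X Y : ZFSet, X ∈ U → Y ∈ U → X ∩ Y ∈ U) ∧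
  (∀ X Y : ZFSet, X ∈ U → X ⊆ Y → Y ⊆ κ → Y ∈ U) ∧
  (∀ X : ZFSet, X ⊆ κ → (X ∈ U ∨ κ \ X ∈ U)) ∧
  (∀ ξ ∈ κ, ({ξ} : ZFSet) ∉ U) ∧
  (∀ γ f : ZFSet, γ ∈ κ → IsFuncInto γ U.toSet f →
    ZFSet.sep (fun ξ => ∀ a X : ZFSet, ZFSet.pair a X ∈ f → ξ ∈ X) κ ∈ U) ∧
  (∀ f : ZFSet, IsFuncInto κ U.toSet f →
    ZFSet.sep (fun ξ => ∀ a X : ZFSet, ZFSet.pair a X ∈ f → a ∈ ξ → ξ ∈ X) κ ∈ U)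

end LaverDiamond

open LaverDiamond

namespace LaverDiamond

/-- The membership relation symbol of the language of set theory. -/
def memSym : SetLang.Relations 2 := memRel.mem

theorem relMap_memSym {M : Set ZFSet.{u}} (x : Fin 2 → M) :
    Language.Structure.RelMap memSym x ↔ (x 0 : ZFSet.{u}) ∈ (x 1 : ZFSet.{u}) := Iff.rfl

/-- Drop the first variable of an assignment. -/
def tl {n : ℕ} (w : Fin (n + 1) → ZFSet.{u}) : Fin n → ZFSet.{u} := fun i => w i.succ

/-- The term `t` is one of the variables. -/
class Proj {n : ℕ} (t : (Fin n → ZFSet.{u}) → ZFSet.{u}) : Prop where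
  out : ∃ i, ∀ v, t v = v i

/-- The map `s` rearranges the variables. -/
class Sub {m n : ℕ} (s : (Fin m → ZFSet.{u}) → Fin n → ZFSet.{u}) : Prop where
  out : ∃ σ : Fin n → Fin m, ∀ w i, s w i = w (σ i)

instance {n : ℕ} : Sub (fun w : Fin n → ZFSet.{u} => w) := ⟨id, fun _ _ => rfl⟩

instance {m n : ℕ} {s : (Fin m → ZFSet.{u}) → Fin (n + 1) → ZFSet.{u}} [hs : Sub s] :
    Sub (fun w => tl (s w)) := by
  obtain ⟨σ, hσ⟩ := hs.out
  exact ⟨fun i => σ i.succ, fun w i => hσ w _⟩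

instance {n : ℕ} : Sub (tl : (Fin (n + 1) → ZFSet.{u}) → Fin n → ZFSet.{u}) :=
  ⟨Fin.succ, fun _ _ => rfl⟩

instance {m n : ℕ} {s : (Fin m → ZFSet.{u}) → Fin n → ZFSet.{u}} [hs : Sub s] (i : Fin n) :
    Proj (fun w => s w i) := by
  obtain ⟨σ, hσ⟩ := hs.out
  exact ⟨σ i, fun w => hσ w i⟩

instance {m n : ℕ} {s : (Fin m → ZFSet.{u}) → Fin (n + 1) → ZFSet.{u}} [hs : Sub s]
    {t : (Fin n → ZFSet.{u}) → ZFSet.{u}} [ht : Proj t] : Proj (fun w => t (tl (s w))) := by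
  obtain ⟨σ, hσ⟩ := hs.out
  obtain ⟨i, hi⟩ := ht.out
  exact ⟨σ i.succ, fun w => (hi _).trans (hσ w _)⟩

/-- The predicate `Q`, in which the class `M` may be quantified over, is expressed by a first-order
formula in every transitive class `M`. -/
class Def {n : ℕ} (Q : Set ZFSet.{u} → (Fin n → ZFSet.{u}) → Prop) : Prop where
  out : ∃ φ : SetLang.Formula (Fin n), ∀ M : Set ZFSet.{u}, TransClass M →
    ∀ (v : Fin n → ZFSet.{u}) (hv : ∀ i, v i ∈ M),
      φ.Realize (fun i => (⟨v i, hv i⟩ : M)) ↔ Q M v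

section Definability

variable {n : ℕ} {P Q : Set ZFSet.{u} → (Fin n → ZFSet.{u}) → Prop}
  {s t : (Fin n → ZFSet.{u}) → ZFSet.{u}}

instance Def.mem [hs : Proj s] [ht : Proj t] : Def (fun _ v => s v ∈ t v) := by
  obtain ⟨i, hi⟩ := hs.out
  obtain ⟨k, hk⟩ := ht.out
  refine ⟨Language.Relations.formula memSym
    ![Language.Term.var i, Language.Term.var k], fun M _ v hv => ?_⟩
  rw [hi, hk, Language.Formula.realize_rel, relMap_memSym]
  rfl

instance Def.eq [hs : Proj s] [ht : Proj t] : Def (fun _ v => s v = t v) := by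
  obtain ⟨i, hi⟩ := hs.out
  obtain ⟨k, hk⟩ := ht.out
  refine ⟨Language.Term.equal (Language.Term.var i) (Language.Term.var k), fun M _ v hv => ?_⟩
  rw [hi, hk, Language.Formula.realize_equal]
  simp

instance Def.not [hP : Def P] : Def (fun M v => ¬ P M v) := by
  obtain ⟨φ, hφ⟩ := hP.out
  refine ⟨φ.not, fun M hM v hv => ?_⟩
  rw [Language.Formula.realize_not, hφ M hM]

instance Def.imp [hP : Def P] [hQ : Def Q] : Def (fun M v => P M v → Q M v) := by
  obtain ⟨φ, hφ⟩ := hP.out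
  obtain ⟨ψ, hψ⟩ := hQ.out
  refine ⟨φ.imp ψ, fun M hM v hv => ?_⟩
  rw [Language.Formula.realize_imp, hφ M hM, hψ M hM]

instance Def.and [hP : Def P] [hQ : Def Q] : Def (fun M v => P M v ∧ Q M v) := by
  obtain ⟨φ, hφ⟩ := hP.out
  obtain ⟨ψ, hψ⟩ := hQ.out
  refine ⟨φ ⊓ ψ, fun M hM v hv => ?_⟩
  rw [Language.Formula.realize_inf, hφ M hM, hψ M hM]

instance Def.or [hP : Def P] [hQ : Def Q] : Def (fun M v => P M v ∨ Q M v) := by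
  obtain ⟨φ, hφ⟩ := hP.out
  obtain ⟨ψ, hψ⟩ := hQ.out
  refine ⟨φ ⊔ ψ, fun M hM v hv => ?_⟩
  rw [Language.Formula.realize_sup, hφ M hM, hψ M hM]

instance Def.iff [hP : Def P] [hQ : Def Q] : Def (fun M v => P M v ↔ Q M v) := by
  obtain ⟨φ, hφ⟩ := hP.out
  obtain ⟨ψ, hψ⟩ := hQ.out
  refine ⟨φ.iff ψ, fun M hM v hv => ?_⟩
  rw [Language.Formula.realize_iff, hφ M hM, hψ M hM]

variable {R : Set ZFSet.{u} → (Fin n → ZFSet.{u}) → ZFSet.{u} → Prop}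

instance Def.all [hR : Def (fun M (w : Fin (n + 1) → ZFSet.{u}) => R M (tl w) (w 0))] :
    Def (fun M v => ∀ x, x ∈ M → R M v x) := by
  obtain ⟨φ, hφ⟩ := hR.out
  let g : Fin (n + 1) → Fin n ⊕ Fin 1 := Fin.cons (Sum.inr 0) Sum.inl
  refine ⟨Language.Formula.iAlls (Fin 1) (Language.Formula.relabel g φ), fun M hM v hv => ?_⟩
  rw [Language.Formula.realize_iAlls]
  have key : ∀ x (hx : x ∈ M), (Language.Formula.relabel g φ).Realize
      (Sum.elim (fun i => (⟨v i, hv i⟩ : M)) (fun _ => ⟨x, hx⟩)) ↔ R M v x := by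
    intro x hx
    have hw : ∀ i, (Fin.cons x v : Fin (n + 1) → ZFSet.{u}) i ∈ M := Fin.cases hx hv
    rw [Language.Formula.realize_relabel]
    refine Iff.trans (iff_of_eq ?_) (hφ M hM (Fin.cons x v) hw)
    congr 1
    funext i
    refine Fin.cases ?_ (fun i => ?_) i <;> rfl
  constructor
  · intro h x hx
    exact (key x hx).1 (h _)
  · intro h i
    have := (key (i 0).1 (i 0).2).2 (h _ (i 0).2)
    convert this using 2
    funext k
    rw [Subsingleton.elim k 0]

instance Def.ex [hR : Def (fun M (w : Fin (n + 1) → ZFSet.{u}) => R M (tl w) (w 0))] :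
    Def (fun M v => ∃ x, x ∈ M ∧ R M v x) := by
  have h : Def (fun M v => ¬ ∀ x, x ∈ M → ¬ R M v x) := inferInstance
  simpa using h

theorem Def.congr (hP : Def P) (h : ∀ M, TransClass M → ∀ v, (∀ i, v i ∈ M) → (P M v ↔ Q M v)) :
    Def Q := by
  obtain ⟨φ, hφ⟩ := hP.out
  exact ⟨φ, fun M hM v hv => (hφ M hM v hv).trans (h M hM v hv)⟩

instance Def.ball [ht : Proj t]
    [hR : Def (fun M (w : Fin (n + 1) → ZFSet.{u}) => R M (tl w) (w 0))] :
    Def (fun M v => ∀ x, x ∈ t v → R M v x) := by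
  have : Def (fun _ (w : Fin (n + 1) → ZFSet.{u}) => w 0 ∈ t (tl w)) := inferInstance
  have h : Def (fun M v => ∀ x, x ∈ M → x ∈ t v → R M v x) := Def.all (hR := Def.imp)
  obtain ⟨i, hi⟩ := ht.out
  refine h.congr fun M hM v hv => ⟨fun h x hx => h x (hM _ (hv i) _ (hi v ▸ hx)) hx,
    fun h x _ => h x⟩

instance Def.bex [ht : Proj t]
    [hR : Def (fun M (w : Fin (n + 1) → ZFSet.{u}) => R M (tl w) (w 0))] :
    Def (fun M v => ∃ x, x ∈ t v ∧ R M v x) := by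
  have h : Def (fun M v => ¬ ∀ x, x ∈ t v → ¬ R M v x) := inferInstance
  simpa using h

instance Def.subset [Proj s] [Proj t] : Def (fun _ v => s v ⊆ t v) := by
  have h : Def (fun _ v => ∀ x, x ∈ s v → x ∈ t v) := inferInstance
  exact h

variable {a b p : (Fin n → ZFSet.{u}) → ZFSet.{u}}

instance Def.eq_singleton [Proj a] [Proj p] : Def (fun _ v => p v = {a v}) := by
  have h : Def (fun _ v => a v ∈ p v ∧ ∀ x, x ∈ p v → x = a v) := inferInstance
  refine h.congr fun M _ v _ => ⟨fun h => ?_, fun h => by simp [h]⟩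
  ext z
  rw [ZFSet.mem_singleton]
  exact ⟨h.2 z, fun hz => hz ▸ h.1⟩

instance Def.eq_upair [Proj a] [Proj b] [Proj p] : Def (fun _ v => p v = {a v, b v}) := by
  have h : Def (fun _ v => a v ∈ p v ∧ b v ∈ p v ∧ ∀ x, x ∈ p v → x = a v ∨ x = b v) :=
    inferInstance
  refine h.congr fun M _ v _ => ⟨fun h => ?_, fun h => by simp [h]⟩
  ext z
  rw [ZFSet.mem_pair]
  exact ⟨h.2.2 z, by rintro (rfl | rfl); exacts [h.1, h.2.1]⟩

instance Def.eq_pair [Proj a] [Proj b] [Proj p] :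
    Def (fun _ v => p v = ZFSet.pair (a v) (b v)) := by
  have h : Def (fun _ v => (∃ x, x ∈ p v ∧ x = {a v}) ∧ (∃ x, x ∈ p v ∧ x = {a v, b v}) ∧
      ∀ x, x ∈ p v → x = {a v} ∨ x = {a v, b v}) := inferInstance
  refine h.congr fun M _ v _ => ⟨fun h => ?_, fun h => by simp [h, ZFSet.pair]⟩
  obtain ⟨⟨x, hx, rfl⟩, ⟨y, hy, rfl⟩, h⟩ := h
  ext z
  rw [ZFSet.pair, ZFSet.mem_pair]
  exact ⟨h z, by rintro (rfl | rfl); exacts [hx, hy]⟩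

instance Def.pair_mem [Proj a] [Proj b] [Proj p] :
    Def (fun _ v => ZFSet.pair (a v) (b v) ∈ p v) := by
  have h : Def (fun _ v => ∃ x, x ∈ p v ∧ x = ZFSet.pair (a v) (b v)) := inferInstance
  simpa using h

end Definability
end LaverDiamond
namespace LaverDiamond

theorem transClass_V : TransClass V.{u} := fun _ _ _ _ => trivial

namespace SCEmb

variable {κ θ : ZFSet.{u}} (E : SCEmb κ θ)

theorem transfer {n : ℕ} (v : Fin n → ZFSet.{u})
    (Q : Set ZFSet.{u} → (Fin n → ZFSet.{u}) → Prop) [hQ : Def Q] : Q V v ↔ Q E.M (fun i => E.e.j (v i)) := by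
  obtain ⟨φ, hφ⟩ := hQ.out
  rw [← hφ V transClass_V v (fun _ => trivial), E.e.elem φ v (fun _ => trivial),
    hφ E.M E.trans _ (fun i => E.e.maps _ trivial)]

theorem j_mem (x : ZFSet.{u}) : E.e.j x ∈ E.M := E.e.maps _ trivial

theorem j_mem_j {x y : ZFSet.{u}} : E.e.j x ∈ E.e.j y ↔ x ∈ y :=
  (E.transfer ![x, y] (fun _ v => v 0 ∈ v 1)).symm

theorem j_pair (x y : ZFSet.{u}) : E.e.j (ZFSet.pair x y) = ZFSet.pair (E.e.j x) (E.e.j y) :=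
  (E.transfer ![x, y, ZFSet.pair x y] (fun _ v => v 2 = ZFSet.pair (v 0) (v 1))).1 rfl

theorem j_subset {x y : ZFSet.{u}} (h : x ⊆ y) : E.e.j x ⊆ E.e.j y :=
  (E.transfer ![x, y] (fun _ v => v 0 ⊆ v 1)).1 h

end SCEmb

/-- `r` attaches to each member of the transitive set `u` a member of `α`, decreasingly. -/
def RF (u r α : ZFSet.{u}) : Prop :=
  (∀ x, x ∈ u → ∀ y, y ∈ x → y ∈ u) ∧
  (∀ x, x ∈ u → ∃ b, b ∈ α ∧ ZFSet.pair x b ∈ r) ∧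
  ∀ x, x ∈ u → ∀ y, y ∈ x → ∀ b, b ∈ α → ∀ c, c ∈ α →
    ZFSet.pair x b ∈ r → ZFSet.pair y c ∈ r → c ∈ b

/-- In `K`, the set `x` is seen to have rank below `γ`. -/
def Low (K γ x : ZFSet.{u}) : Prop :=
  ∃ w, w ∈ K ∧ ∃ r, r ∈ K ∧ ∃ α, α ∈ γ ∧ x ∈ w ∧ RF w r α

/-- `s` is a binary relation on `t`. -/
def Rel (t s : ZFSet.{u}) : Prop :=
  ∀ p, p ∈ s → ∃ x, x ∈ t ∧ ∃ y, y ∈ t ∧ p = ZFSet.pair x y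

/-- The part of the definition of a Laver measure in which all quantifiers are bounded. -/
def Good₀ (γ f β t A U : ZFSet.{u}) : Prop :=
  (∀ X, X ∈ U → ∀ s, s ∈ X → Rel t s) ∧
  (∀ X, X ∈ U → ∃ s, s ∈ X ∧ Rel t s) ∧
  (∀ X, X ∈ U → ∀ Y, Y ∈ U → ∃ Z, Z ∈ U ∧ Z ⊆ X ∧ Z ⊆ Y) ∧
  (∀ x, x ∈ t → ∃ X, X ∈ U ∧ ∀ s, s ∈ X → ∃ a, a ∈ t ∧ ZFSet.pair a x ∈ s) ∧
  (∃ X, X ∈ U ∧ ∀ s, s ∈ X → ∀ a, a ∈ t → ∀ x, x ∈ t → ∀ b, b ∈ t → ∀ y, y ∈ t →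
    ZFSet.pair a x ∈ s → ZFSet.pair b y ∈ s → (a ∈ b ↔ x ∈ y)) ∧
  (∃ X, X ∈ U ∧ ∀ s, s ∈ X → ∀ a, a ∈ t → ∀ x, x ∈ t → ZFSet.pair a x ∈ s →
    ∀ c, c ∈ a → ∃ z, z ∈ t ∧ ZFSet.pair c z ∈ s) ∧
  (∀ α, α ∈ γ → ∃ X, X ∈ U ∧ ∀ s, s ∈ X → ∀ ξ, ξ ∈ α → ZFSet.pair ξ ξ ∈ s) ∧
  (∃ X, X ∈ U ∧ ∀ s, s ∈ X → ∃ a, a ∈ γ ∧ ∃ b, b ∈ t ∧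
    ZFSet.pair a γ ∈ s ∧ ZFSet.pair b A ∈ s ∧ ZFSet.pair a b ∈ f) ∧
  (∀ ξ, ξ ∈ β → ξ ∈ t → ∃ X, X ∈ U ∧ ∀ s, s ∈ X → ∃ a, a ∈ γ ∧ ZFSet.pair a ξ ∈ s)

/-- `X` is decided by the filter base `U`. -/
def Decides (U X : ZFSet.{u}) : Prop :=
  (∃ Y, Y ∈ U ∧ Y ⊆ X) ∨ ∃ Y, Y ∈ U ∧ ∀ s, s ∈ Y → ¬ s ∈ X

/-- Normality of `U` for the choice function coded by `g`. -/
def NormalFor (t U g : ZFSet.{u}) : Prop :=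
  (∃ X, X ∈ U ∧ ∀ s, s ∈ X → ∃ x, x ∈ t ∧ ∃ a, a ∈ t ∧ ZFSet.pair a x ∈ s ∧
    ZFSet.pair s x ∈ g) →
  ∃ x, x ∈ t ∧ ∃ X, X ∈ U ∧ ∀ s, s ∈ X → ZFSet.pair s x ∈ g

/-- `U` is a Laver measure: a fine normal ultrafilter base on the binary relations on `t` whose
generic relation is the restriction to `t` of its ultrapower map, and whose ultrapower map sends
`f` to a function with value `A` at `γ`. -/
def Good (γ f β t A U : ZFSet.{u}) : Prop :=
  Good₀ γ f β t A U ∧ (∀ X, Decides U X) ∧ ∀ g, NormalFor t U g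

/-- `U` is a Laver measure from the point of view of `W`. -/
def GoodIn (W γ f β t A U : ZFSet.{u}) : Prop :=
  Good₀ γ f β t A U ∧ (∀ X, X ∈ W → Decides U X) ∧ ∀ g, g ∈ W → NormalFor t U g

/-- In `W`, there is no Laver measure for the data. -/
def Cex (W γ f β t A : ZFSet.{u}) : Prop :=
  (∃ r, r ∈ W ∧ RF t r β) ∧ A ∈ t ∧ γ ∈ t ∧ (∀ x, x ∈ W → Low W γ x → x ∈ t) ∧
    ∀ U, U ∈ W → ¬ GoodIn W γ f β t A U

/-- `f` contains a counterexample of minimal height at each point where there is one. -/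
def Guess (W κ f : ZFSet.{u}) : Prop :=
  ∀ γ, γ ∈ κ → ∀ β, β ∈ κ → (∃ t, t ∈ W ∧ ∃ A, A ∈ W ∧ Cex W γ f β t A) →
    ∃ β', β' ∈ κ ∧ (β' ∈ β ∨ β' = β) ∧ ∃ t, t ∈ W ∧ ∃ A, A ∈ W ∧ Cex W γ f β' t A ∧
      ZFSet.pair γ A ∈ f

section Definability

variable {n : ℕ} {a b c d e f g : (Fin n → ZFSet.{u}) → ZFSet.{u}}
  [Proj a] [Proj b] [Proj c] [Proj d] [Proj e] [Proj f] [Proj g]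

instance Def.RF : Def (fun _ v => RF (a v) (b v) (c v)) := by
  unfold LaverDiamond.RF; infer_instance

instance Def.Low : Def (fun _ v => Low (a v) (b v) (c v)) := by
  unfold LaverDiamond.Low; infer_instance

instance Def.Rel : Def (fun _ v => Rel (a v) (b v)) := by
  unfold LaverDiamond.Rel; infer_instance

instance Def.Good₀ : Def (fun _ v => Good₀ (a v) (b v) (c v) (d v) (e v) (f v)) := by
  unfold LaverDiamond.Good₀
  repeat' refine Def.and (hP := ?_) (hQ := ?_)
  all_goals infer_instance

instance Def.Decides : Def (fun _ v => Decides (a v) (b v)) := by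
  unfold LaverDiamond.Decides; infer_instance

instance Def.NormalFor : Def (fun _ v => NormalFor (a v) (b v) (c v)) := by
  unfold LaverDiamond.NormalFor; infer_instance

instance Def.GoodIn : Def (fun _ v => GoodIn (a v) (b v) (c v) (d v) (e v) (f v) (g v)) := by
  unfold LaverDiamond.GoodIn; infer_instance

instance Def.Cex : Def (fun _ v => Cex (a v) (b v) (c v) (d v) (e v) (f v)) := by
  unfold LaverDiamond.Cex; infer_instance

instance Def.Guess : Def (fun _ v => Guess (a v) (b v) (c v)) := by
  unfold LaverDiamond.Guess; infer_instance

end Definability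

end LaverDiamond
open ZFSet in
theorem ZFSet.mk_toSet (x : ZFSet.{u}) :
    Cardinal.mk x.toSet = Cardinal.lift.{u + 1, u} x.card := cardinalMk_coe_sort

namespace LaverDiamond

open ZFSet

theorem RF.rank_lt {w r α : ZFSet.{u}} (h : RF w r α) {x : ZFSet.{u}} (hx : x ∈ w) :
    x.rank < α.rank := by
  have key : ∀ x, x ∈ w → ∀ b ∈ α, pair x b ∈ r → x.rank ≤ b.rank := by
    intro x
    induction x using ZFSet.inductionOn with
    | _ x ih =>
      intro hx b hb hxb
      rw [rank_le_iff]
      intro y hy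
      obtain ⟨c, hc, hyc⟩ := h.2.1 y (h.1 x hx y hy)
      exact (ih y hy (h.1 x hx y hy) c hc hyc).trans_lt
        (rank_lt_of_mem (h.2.2 x hx y hy b hb c hc hxb hyc))
  obtain ⟨b, hb, hxb⟩ := h.2.1 x hx
  exact (key x hx b hb hxb).trans_lt (rank_lt_of_mem hb)

/-- The rank function on `V_ o`. -/
noncomputable def rankFn (o : Ordinal.{u}) : ZFSet.{u} :=
  ZFSet.sep (fun p => ∃ x, p = pair x x.rank.toZFSet) (ZFSet.prod (V_ o) o.toZFSet)

theorem rf_vonNeumann (o : Ordinal.{u}) : RF (V_ o) (rankFn o) o.toZFSet := by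
  refine ⟨fun x hx y hy => (isTransitive_vonNeumann o) x hx hy, fun x hx => ?_, ?_⟩
  · rw [mem_vonNeumann] at hx
    refine ⟨x.rank.toZFSet, by simpa using hx, ?_⟩
    rw [rankFn, mem_sep, pair_mem_prod]
    exact ⟨⟨by rwa [mem_vonNeumann], by simpa using hx⟩, x, rfl⟩
  · intro x hx y hy b _ c _ hb hc
    obtain ⟨z, hz⟩ := (mem_sep.1 hb).2
    obtain ⟨z', hz'⟩ := (mem_sep.1 hc).2
    obtain ⟨rfl, rfl⟩ := pair_inj.1 hz
    obtain ⟨rfl, rfl⟩ := pair_inj.1 hz'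
    simpa using rank_lt_of_mem hy

theorem exists_isCard (X : ZFSet.{u}) (o : Ordinal.{u}) :
    ∃ θ : ZFSet.{u}, IsCard θ ∧ Cardinal.mk X.toSet ≤ Cardinal.mk θ.toSet ∧ o.toZFSet ∈ θ := by
  let c : Cardinal.{u} := max X.card (Order.succ o.card)
  refine ⟨c.ord.toZFSet, ⟨isOrdinal_toZFSet _, fun β hβ => ?_⟩, ?_, ?_⟩
  · obtain ⟨b, hb, rfl⟩ := Ordinal.mem_toZFSet_iff.1 hβ
    rw [mk_toSet, mk_toSet, Ordinal.card_toZFSet, Ordinal.card_toZFSet, Cardinal.lift_lt,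
      Cardinal.card_ord]
    exact Cardinal.lt_ord.1 hb
  · rw [mk_toSet, mk_toSet, Ordinal.card_toZFSet, Cardinal.lift_le, Cardinal.card_ord]
    exact le_max_left _ _
  · rw [Ordinal.toZFSet_mem_toZFSet_iff, Cardinal.lt_ord]
    exact (Order.lt_succ _).trans_le (le_max_right _ _)

theorem Supercompact.isOrdinal {κ : ZFSet.{u}} (h : Supercompact κ) : κ.IsOrdinal := by
  obtain ⟨θ, hθ, -⟩ := exists_isCard ∅ 0
  exact (h θ hθ).some.crit.1

namespace SCEmb

variable {κ θ : ZFSet.{u}} (E : SCEmb κ θ)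

theorem j_eq_of_mem {x : ZFSet.{u}} (hx : x.rank < κ.rank) : E.e.j x = x := by
  obtain ⟨o, ho⟩ : ∃ o, x.rank = o := ⟨_, rfl⟩
  induction o using WellFoundedLT.induction generalizing x with
  | ind o ih =>
    have hα : E.e.j o.toZFSet = o.toZFSet := by
      refine E.crit.2.2 _ (isOrdinal_toZFSet o) ?_
      rw [← E.crit.1.toZFSet_rank_eq, Ordinal.toZFSet_mem_toZFSet_iff]
      exact ho ▸ hx
    have h₁ : RF (E.e.j (V_ o)) (E.e.j (rankFn o)) (E.e.j o.toZFSet) :=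
      (E.transfer ![V_ o, rankFn o, o.toZFSet] (fun _ v => RF (v 0) (v 1) (v 2))).1
        (rf_vonNeumann o)
    rw [hα] at h₁
    have h₂ : E.e.j x ⊆ E.e.j (V_ o) := E.j_subset (subset_vonNeumann.2 ho.le)
    have fix : ∀ y : ZFSet.{u}, y.rank < o → E.e.j y = y := fun y hy =>
      ih _ hy (hy.trans (ho ▸ hx)) rfl
    ext y
    constructor
    · intro hy
      have hr := h₁.rank_lt (h₂ hy)
      rw [Ordinal.rank_toZFSet] at hr
      rwa [← fix y hr, E.j_mem_j] at hy
    · intro hy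
      rw [← fix y (ho ▸ rank_lt_of_mem hy), E.j_mem_j]
      exact hy

theorem trans_j {x y : ZFSet.{u}} (hx : x ∈ y) (hy : y ∈ E.e.j κ) : x ∈ E.e.j κ :=
  (E.transfer ![κ] (fun _ v => ∀ y, y ∈ v 0 → ∀ x, x ∈ y → x ∈ v 0)).1
    (fun _ hy _ hx => E.crit.1.mem_trans hx hy) y hy x hx

theorem mem_of_subset {x : ZFSet.{u}} (hx : ∀ y, y ∈ x → y ∈ E.M)
    (hc : Cardinal.mk x.toSet ≤ Cardinal.mk θ.toSet) : x ∈ E.M := by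
  rcases x.eq_empty_or_nonempty with rfl | ⟨z, hz⟩
  · have : E.e.j ∅ = ∅ := by
      refine (eq_empty _).2 fun y hy => ?_
      exact (E.transfer ![∅] (fun _ v => ∀ y, y ∈ v 0 → ¬ y = y)).1
        (fun y hy => absurd hy (notMem_empty y)) y hy rfl
    exact this ▸ E.j_mem ∅
  · have : Nonempty x.toSet := ⟨⟨z, hz⟩⟩
    obtain ⟨i, hi⟩ := hc
    let g : θ.toSet → x.toSet := Function.invFun (⟨i, hi⟩ : x.toSet ↪ θ.toSet)
    have hg : Function.Surjective g := Function.invFun_surjective hi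
    let f : ZFSet.{u} := ZFSet.sep (fun p => ∃ a : θ.toSet, p = pair a (g a)) (ZFSet.prod θ x)
    have hf : ∀ a b, pair a b ∈ f ↔ ∃ h : a ∈ θ, b = g ⟨a, h⟩ := by
      intro a b
      simp only [f, mem_sep, pair_mem_prod]
      constructor
      · rintro ⟨⟨h, -⟩, c, hc⟩
        obtain ⟨rfl, rfl⟩ := pair_inj.1 hc
        exact ⟨h, rfl⟩
      · rintro ⟨h, rfl⟩
        exact ⟨⟨h, (g _).2⟩, ⟨a, h⟩, rfl⟩
    have hfM : f ∈ E.M := by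
      refine E.closed f ⟨fun p hp => ?_, fun a ha => ⟨g ⟨a, ha⟩, (hf _ _).2 ⟨ha, rfl⟩, ?_⟩⟩
      · obtain ⟨a, rfl⟩ := (mem_sep.1 hp).2
        exact ⟨a, g a, a.2, hx _ (g a).2, rfl⟩
      · intro b hb
        exact ((hf _ _).1 hb).2
    obtain ⟨R, hR, hRf⟩ := (E.transfer ![] (fun M _ => ∀ f, f ∈ M → ∃ R, R ∈ M ∧ ∀ y, y ∈ M →
      (y ∈ R ↔ ∃ a, a ∈ M ∧ pair a y ∈ f))).1 (fun f _ => by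
        refine ⟨ZFSet.sep (fun y => ∃ a, pair a y ∈ f) (⋃₀ (⋃₀ f : ZFSet) : ZFSet), trivial,
          fun y _ => ?_⟩
        rw [mem_sep]
        refine ⟨fun ⟨_, a, h⟩ => ⟨a, trivial, h⟩, fun ⟨a, _, h⟩ => ⟨?_, a, h⟩⟩
        rw [mem_sUnion]
        refine ⟨{a, y}, ?_, by simp⟩
        rw [mem_sUnion]
        exact ⟨_, h, by simp [pair]⟩) f hfM
    have : x = R := by
      ext y
      constructor
      · intro hy
        obtain ⟨a, ha⟩ := hg ⟨y, hy⟩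
        refine (hRf y (hx y hy)).2 ⟨a, E.trans _ (E.j_mem κ) _ (E.trans_j a.2 E.big), ?_⟩
        rw [hf]
        exact ⟨a.2, by rw [ha]⟩
      · intro hy
        obtain ⟨a, -, ha⟩ := (hRf y (E.trans _ hR _ hy)).1 hy
        obtain ⟨h, rfl⟩ := (hf _ _).1 ha
        exact (g _).2
    exact this ▸ hR

theorem mem_of_isTransitive {X : ZFSet.{u}} (hX : X.IsTransitive)
    (hc : Cardinal.mk X.toSet ≤ Cardinal.mk θ.toSet) {x : ZFSet.{u}} (hx : x ∈ X) : x ∈ E.M := by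
  induction x using ZFSet.inductionOn with
  | _ x ih =>
    refine E.mem_of_subset (fun y hy => ih y hy (hX x hx hy)) (le_trans ?_ hc)
    rw [mk_toSet, mk_toSet, Cardinal.lift_le]
    exact card_mono (hX x hx)

end SCEmb

theorem Supercompact.exists_emb {κ : ZFSet.{u}} (h : Supercompact κ) (o : Ordinal.{u}) :
    ∃ θ, ∃ E : SCEmb κ θ, V_ o ⊆ E.e.j (V_ κ.rank) ∧ o.toZFSet ∈ E.e.j κ ∧
      ∀ x, (∀ y, y ∈ x → y ∈ E.M) → Cardinal.mk x.toSet ≤ Cardinal.mk (V_ o).toSet →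
        x ∈ E.M := by
  let m := Order.succ (max (rank (V_ o)) (rank (rankFn o)))
  obtain ⟨θ, hθ, hc, ho⟩ := exists_isCard (V_ m) o
  obtain ⟨E⟩ := h θ hθ
  have ho' := E.trans_j ho E.big
  have hV : ∀ x, x ∈ V_ m → x ∈ E.M := fun x hx =>
    E.mem_of_isTransitive (isTransitive_vonNeumann _) hc hx
  have hom : o ≤ m := by
    exact (rank_vonNeumann o).symm.le.trans ((le_max_left _ _).trans (Order.le_succ _))
  refine ⟨θ, E, ?_, ho', fun x hx hxo => E.mem_of_subset hx (hxo.trans (le_trans ?_ hc))⟩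
  swap
  · rw [mk_toSet, mk_toSet, Cardinal.lift_le]
    exact card_mono (vonNeumann_subset_of_le hom)
  refine (E.transfer ![κ, V_ κ.rank] (fun M v => ∀ w, w ∈ M → ∀ r, r ∈ M → ∀ α, α ∈ v 0 →
    RF w r α → w ⊆ v 1)).1 (fun w _ r _ α hα hw x hx => ?_) (V_ o) (hV _ ?_) (rankFn o) (hV _ ?_)
    o.toZFSet ho' (rf_vonNeumann o)
  · exact mem_vonNeumann.2 ((hw.rank_lt hx).trans (rank_lt_of_mem hα))
  · exact mem_vonNeumann.2 (Order.lt_succ_of_le (le_max_left _ _))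
  · exact mem_vonNeumann.2 (Order.lt_succ_of_le (le_max_right _ _))

end LaverDiamond
namespace LaverDiamond

open ZFSet

theorem Cex.of_eqOn {W γ f f' β t A : ZFSet.{u}}
    (h : ∀ a, a ∈ γ → ∀ b, pair a b ∈ f ↔ pair a b ∈ f') (hC : Cex W γ f β t A) :
    Cex W γ f' β t A := by
  obtain ⟨h₁, h₂, h₃, h₄, h₅⟩ := hC
  refine ⟨h₁, h₂, h₃, h₄, fun U hU hG => h₅ U hU ⟨?_, hG.2⟩⟩
  obtain ⟨g₁, g₂, g₃, g₄, g₅, g₆, g₇, ⟨X, hX, g₈⟩, g₉⟩ := hG.1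
  refine ⟨g₁, g₂, g₃, g₄, g₅, g₆, g₇, ⟨X, hX, fun s hs => ?_⟩, g₉⟩
  obtain ⟨a, ha, b, hb, k₁, k₂, k₃⟩ := g₈ s hs
  exact ⟨a, ha, b, hb, k₁, k₂, (h a ha b).2 k₃⟩

theorem exists_min_cex {κ : ZFSet.{u}} (hκ : κ.IsOrdinal) (W γ f : ZFSet.{u}) :
    ∃ S : Set ZFSet.{u}, S.Subsingleton ∧ (∀ A ∈ S, A ∈ W) ∧
      ∀ β, β ∈ κ → (∃ t, t ∈ W ∧ ∃ A, A ∈ W ∧ Cex W γ f β t A) →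
        ∃ β', β' ∈ κ ∧ (β' ∈ β ∨ β' = β) ∧ ∃ t, t ∈ W ∧ ∃ A, A ∈ W ∧ Cex W γ f β' t A ∧ A ∈ S := by
  by_cases hex : ∃ β, β ∈ κ ∧ ∃ t, t ∈ W ∧ ∃ A, A ∈ W ∧ Cex W γ f β t A
  · obtain ⟨β₀, ⟨hβ₀, t, ht, A, hA, hC⟩, hmin⟩ := ZFSet.mem_wf.has_min
      {β : ZFSet.{u} | β ∈ κ ∧ ∃ t, t ∈ W ∧ ∃ A, A ∈ W ∧ Cex W γ f β t A} hex
    refine ⟨{A}, Set.subsingleton_singleton, by simpa using hA, fun β hβ h => ?_⟩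
    refine ⟨β₀, hβ₀, ?_, t, ht, A, hA, hC, rfl⟩
    rcases (hκ.mem hβ₀).mem_trichotomous (hκ.mem hβ) with h' | h' | h'
    · exact Or.inl h'
    · exact Or.inr h'
    · exact absurd h' (hmin β ⟨hβ, h⟩)
  · exact ⟨∅, Set.subsingleton_empty, by simp, fun β hβ h => absurd ⟨β, hβ, h⟩ hex⟩

theorem exists_guess {κ : ZFSet.{u}} (hκ : κ.IsOrdinal) :
    ∃ f, IsPFun κ f ∧ Guess (V_ κ.rank) κ f := by
  choose S hS₁ hS₂ hS₃ using exists_min_cex hκ (V_ κ.rank)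
  let F : ZFSet.{u} → Set ZFSet.{u} := ZFSet.mem_wf.fix fun γ F =>
    S γ (ZFSet.sep (fun p => ∃ a, ∃ h : a ∈ γ, ∃ b ∈ F a h, p = pair a b)
      (ZFSet.prod κ (V_ κ.rank)))
  have hF : ∀ γ, F γ = S γ (ZFSet.sep (fun p => ∃ a, ∃ _ : a ∈ γ, ∃ b ∈ F a, p = pair a b)
      (ZFSet.prod κ (V_ κ.rank))) := fun γ => ZFSet.mem_wf.fix_eq _ γ
  let f := ZFSet.sep (fun p => ∃ a, ∃ b ∈ F a, p = pair a b) (ZFSet.prod κ (V_ κ.rank))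
  have hf : ∀ a b, pair a b ∈ f ↔ a ∈ κ ∧ b ∈ F a := by
    intro a b
    simp only [f, mem_sep, pair_mem_prod]
    constructor
    · rintro ⟨⟨h, -⟩, c, d, hd, e⟩
      obtain ⟨rfl, rfl⟩ := pair_inj.1 e
      exact ⟨h, hd⟩
    · rintro ⟨h, hb⟩
      exact ⟨⟨h, hS₂ _ _ _ (hF a ▸ hb)⟩, a, b, hb, rfl⟩
  refine ⟨f, ⟨fun p hp => ?_, fun γ A B hA hB => ?_⟩, fun γ hγ β hβ hex => ?_⟩
  · obtain ⟨h, a, b, hb, rfl⟩ := mem_sep.1 hp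
    rw [pair_mem_prod, mem_vonNeumann] at h
    exact ⟨a, b, h.1, h.2, rfl⟩
  · have h₁ := ((hf _ _).1 hA).2
    have h₂ := ((hf _ _).1 hB).2
    rw [hF] at h₁ h₂
    exact hS₁ _ _ h₁ h₂
  · set f' := ZFSet.sep (fun p => ∃ a, ∃ _ : a ∈ γ, ∃ b ∈ F a, p = pair a b)
      (ZFSet.prod κ (V_ κ.rank)) with hf'
    have hff' : ∀ a, a ∈ γ → ∀ b, pair a b ∈ f ↔ pair a b ∈ f' := by
      intro a ha b
      simp only [f, hf', mem_sep]
      refine and_congr_right fun _ => ⟨?_, ?_⟩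
      · rintro ⟨c, d, hd, e⟩
        obtain ⟨rfl, rfl⟩ := pair_inj.1 e
        exact ⟨a, ha, b, hd, rfl⟩
      · rintro ⟨c, -, d, hd, e⟩
        exact ⟨c, d, hd, e⟩
    obtain ⟨t, ht, A, hA, hC⟩ := hex
    obtain ⟨β', hβ', hle, t', ht', A', hA', hC', hAS⟩ :=
      hS₃ γ f' β hβ ⟨t, ht, A, hA, hC.of_eqOn hff'⟩
    refine ⟨β', hβ', hle, t', ht', A', hA', hC'.of_eqOn fun a ha b => (hff' a ha b).symm, ?_⟩
    rw [hf, hF]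
    exact ⟨hγ, hAS⟩

end LaverDiamond
namespace LaverDiamond

open ZFSet

theorem Def.subst {m n : ℕ} {Q : Set ZFSet.{u} → (Fin n → ZFSet.{u}) → Prop} (hQ : Def Q)
    (σ : Fin n → Fin m) : Def (fun M w => Q M (fun i => w (σ i))) := by
  obtain ⟨φ, hφ⟩ := hQ.out
  refine ⟨Language.Formula.relabel σ φ, fun M hM v hv => ?_⟩
  rw [Language.Formula.realize_relabel]
  exact hφ M hM (fun i => v (σ i)) (fun i => hv (σ i))

theorem exists_graph (t : ZFSet.{u}) (j : ZFSet.{u} → ZFSet.{u}) :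
    ∃ S : ZFSet.{u}, (∀ p, p ∈ S ↔ ∃ x, x ∈ t ∧ p = pair x (j x)) ∧
      Cardinal.mk S.toSet ≤ Cardinal.mk t.toSet := by
  let S := ZFSet.range (fun x : Shrink.{u} t =>
    pair ((equivShrink t).symm x : ZFSet.{u}) (j ((equivShrink t).symm x)))
  have hS : ∀ p, p ∈ S ↔ ∃ x, x ∈ t ∧ p = pair x (j x) := by
    intro p
    simp only [S, mem_range]
    constructor
    · rintro ⟨x, rfl⟩
      exact ⟨_, ((equivShrink t).symm x).2, rfl⟩
    · rintro ⟨x, hx, rfl⟩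
      exact ⟨equivShrink t ⟨x, hx⟩, by simp⟩
  refine ⟨S, hS, ?_⟩
  refine Cardinal.mk_le_of_surjective
    (f := fun x : t.toSet => (⟨pair x (j x), (hS _).2 ⟨x, x.2, rfl⟩⟩ : S.toSet)) ?_
  rintro ⟨p, hp⟩
  obtain ⟨x, hx, rfl⟩ := (hS p).1 hp
  exact ⟨⟨x, hx⟩, rfl⟩

namespace SCEmb

variable {κ θ : ZFSet.{u}} (E : SCEmb κ θ)

theorem pair_mem {x y : ZFSet.{u}} (hx : x ∈ E.M) (hy : y ∈ E.M) : pair x y ∈ E.M := by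
  obtain ⟨p, hp, rfl⟩ := (E.transfer ![] (fun M _ => ∀ x, x ∈ M → ∀ y, y ∈ M → ∃ p, p ∈ M ∧
    p = pair x y)).1 (fun x _ y _ => ⟨_, trivial, rfl⟩) x hx y hy
  exact hp

theorem j_eq_self {x : ZFSet.{u}} (hx : x ∈ κ) : E.e.j x = x :=
  E.j_eq_of_mem (rank_lt_of_mem hx)

theorem exists_gt (E : SCEmb κ θ) {α : ZFSet.{u}} (hα : α ∈ κ) : ∃ α', α' ∈ κ ∧ α ∈ α' := by
  by_contra! h
  have h' : ∀ x, x ∈ κ → x ∈ α ∨ x = α := by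
    intro x hx
    rcases (E.crit.1.mem hα).mem_trichotomous (E.crit.1.mem hx) with h' | h' | h'
    exacts [absurd h' (h x hx), Or.inr h'.symm, Or.inl h']
  have := (E.transfer ![κ, α] (fun _ v => ∀ x, x ∈ v 0 → x ∈ v 1 ∨ x = v 1)).1 h' κ E.crit.2.1
  change κ ∈ E.e.j α ∨ κ = E.e.j α at this
  rw [E.j_eq_self hα] at this
  rcases this with h₁ | rfl
  · exact mem_asymm h₁ hα
  · exact mem_irrefl _ hα

theorem pair_mem_j {f : ZFSet.{u}} (hf : IsPFun κ f) {a : ZFSet.{u}} (ha : a ∈ κ)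
    (b : ZFSet.{u}) : pair a b ∈ E.e.j f ↔ pair a b ∈ f := by
  have hmem : ∀ b, pair a b ∈ f → pair a b ∈ E.e.j f := by
    intro b hb
    obtain ⟨γ, A, hγ, hA, e⟩ := hf.1 _ hb
    obtain ⟨rfl, rfl⟩ := pair_inj.1 e
    rw [← E.j_mem_j, E.j_pair, E.j_eq_self ha, E.j_eq_of_mem hA] at hb
    exact hb
  refine ⟨fun h => ?_, hmem b⟩
  have hM : pair a b ∈ E.M := E.trans _ (E.j_mem f) _ h
  have hbM : b ∈ E.M := E.trans _ (E.trans _ hM {a, b} (by simp [pair])) _ (by simp)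
  have haM : a ∈ E.M := E.trans _ (E.trans _ hM {a, b} (by simp [pair])) _ (by simp)
  by_cases hex : ∃ b', pair a b' ∈ f
  · obtain ⟨b', hb'⟩ := hex
    have hM' : pair a b' ∈ E.M := E.trans _ (E.j_mem f) _ (hmem b' hb')
    have hbM' : b' ∈ E.M := E.trans _ (E.trans _ hM' {a, b'} (by simp [pair])) _ (by simp)
    have := (E.transfer ![f] (fun M v => ∀ γ, γ ∈ M → ∀ A, A ∈ M → ∀ B, B ∈ M → pair γ A ∈ v 0 →
      pair γ B ∈ v 0 → A = B)).1 (fun γ _ A _ B _ => hf.2 γ A B) a haM b hbM b' hbM' h (hmem b' hb')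
    exact this ▸ hb'
  · push Not at hex
    have := (E.transfer ![a, f] (fun M v => ∀ b, b ∈ M → ¬ pair (v 0) b ∈ v 1)).1
      (fun b _ => hex b) b hbM
    exact absurd h (E.j_eq_self ha ▸ this)

theorem exists_mem_measure {t S : ZFSet.{u}} (hS : S ∈ E.e.j (powerset (prod t t))) {n : ℕ}
    (Q : Set ZFSet.{u} → (Fin (n + 1) → ZFSet.{u}) → Prop) [hQ : Def Q] (v : Fin n → ZFSet.{u})
    (h : Q E.M (Fin.cons S (fun i => E.e.j (v i)))) :
    ∃ X, X ∈ ZFSet.sep (fun X => S ∈ E.e.j X) (powerset (powerset (prod t t))) ∧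
      ∀ s, s ∈ X → s ∈ powerset (prod t t) ∧ Q V (Fin.cons s v) := by
  let P := powerset (prod t t)
  let X := ZFSet.sep (fun s => Q V (Fin.cons s v)) P
  have hD : Def (fun M (w : Fin (n + 1 + 1 + 1) → ZFSet.{u}) =>
      Q M (Fin.cons (w 0) (fun i => w i.succ.succ.succ))) := by
    convert hQ.subst (Fin.cons 0 (fun i => i.succ.succ.succ) : Fin (n + 1) → Fin (n + 1 + 1 + 1))
      using 4 with M w
    funext i
    refine Fin.cases ?_ (fun i => ?_) i <;> rfl
  have hD' : Def (fun M (w : Fin (n + 1 + 1) → ZFSet.{u}) => ∀ s, s ∈ w 1 →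
      Q M (Fin.cons s (fun i => w i.succ.succ)) → s ∈ w 0) :=
    Def.ball (R := fun M w s => Q M (Fin.cons s (fun i => w i.succ.succ)) → s ∈ w 0)
      (hR := Def.imp (hP := hD))
  refine ⟨X, mem_sep.2 ⟨mem_powerset.2 (sep_subset ..), ?_⟩, fun s hs => mem_sep.1 hs⟩
  exact (E.transfer (Fin.cons X (Fin.cons P v)) _ (hQ := hD')).1
    (fun s hs hq => (show s ∈ X from mem_sep.2 ⟨hs, hq⟩)) S hS h

theorem good_of_graph {f β t A S : ZFSet.{u}} (hS : ∀ p, p ∈ S ↔ ∃ x, x ∈ t ∧ p = pair x (E.e.j x))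
    (hSM : S ∈ E.M) (ht : t.IsTransitive) (hVt : ∀ x, x ∈ V_ κ.rank → x ∈ t)
    (htj : ∀ x, x ∈ t → x ∈ E.e.j t) (hκt : κ ∈ t) (hAt : A ∈ t) (hβ : β ∈ E.e.j κ)
    (hA : pair κ A ∈ E.e.j f) :
    Good κ f β t A (ZFSet.sep (fun X => S ∈ E.e.j X) (powerset (powerset (prod t t)))) := by
  have hS' : ∀ a y, pair a y ∈ S ↔ a ∈ t ∧ y = E.e.j a := by
    intro a y
    rw [hS]
    constructor
    · rintro ⟨x, hx, e⟩
      obtain ⟨rfl, rfl⟩ := pair_inj.1 e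
      exact ⟨hx, rfl⟩
    · rintro ⟨h, rfl⟩
      exact ⟨a, h, rfl⟩
  have hSP : S ∈ E.e.j (powerset (prod t t)) := by
    refine (E.transfer ![t, powerset (prod t t)] (fun M v => ∀ s, s ∈ M → Rel (v 0) s → s ∈ v 1)).1
      (fun s _ hs => mem_powerset.2 fun p hp => ?_) S hSM fun p hp => ?_
    · obtain ⟨x, hx, y, hy, rfl⟩ := hs p hp
      exact pair_mem_prod.2 ⟨hx, hy⟩
    · obtain ⟨x, hx, rfl⟩ := (hS p).1 hp
      exact ⟨x, htj x hx, _, E.j_mem_j.2 hx, rfl⟩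
  have hrel : ∀ s, s ∈ powerset (prod t t) → Rel t s := by
    intro s hs p hp
    obtain ⟨x, hx, y, hy, rfl⟩ := mem_prod.1 (mem_powerset.1 hs hp)
    exact ⟨x, hx, y, hy, rfl⟩
  have hU : ∀ X, X ∈ ZFSet.sep (fun X => S ∈ E.e.j X) (powerset (powerset (prod t t))) →
      S ∈ E.e.j X ∧ ∀ s, s ∈ X → Rel t s := fun X hX =>
    ⟨(mem_sep.1 hX).2, fun s hs => hrel s (mem_powerset.1 (mem_sep.1 hX).1 hs)⟩
  have hfix : ∀ x, x ∈ κ → x ∈ t ∧ E.e.j x = x := fun x hx =>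
    ⟨hVt x (mem_vonNeumann.2 (rank_lt_of_mem hx)), E.j_eq_self hx⟩
  refine ⟨⟨fun X hX => (hU X hX).2, ?_, ?_, ?_, ?_, ?_, ?_, ?_, ?_⟩, ?_, ?_⟩
  · intro X hX
    by_contra! h
    exact (E.transfer ![X] (fun _ v => ∀ s, s ∈ v 0 → ¬ s = s)).1
      (fun s hs => absurd ((hU X hX).2 s hs) (h s hs)) S (hU X hX).1 rfl
  · intro X hX Y hY
    obtain ⟨Z, hZ, h⟩ := E.exists_mem_measure hSP (fun _ w => w 0 ∈ w 1 ∧ w 0 ∈ w 2) ![X, Y]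
      ⟨(hU X hX).1, (hU Y hY).1⟩
    exact ⟨Z, hZ, fun s hs => (h s hs).2.1, fun s hs => (h s hs).2.2⟩
  · intro x hx
    obtain ⟨X, hX, h⟩ := E.exists_mem_measure hSP (fun _ w => ∃ a, a ∈ w 1 ∧ pair a (w 2) ∈ w 0)
      ![t, x] ⟨x, htj x hx, (hS' _ _).2 ⟨hx, rfl⟩⟩
    exact ⟨X, hX, fun s hs => (h s hs).2⟩
  · obtain ⟨X, hX, h⟩ := E.exists_mem_measure hSP (fun _ w => ∀ a, a ∈ w 1 → ∀ x, x ∈ w 1 →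
      ∀ b, b ∈ w 1 → ∀ y, y ∈ w 1 → pair a x ∈ w 0 → pair b y ∈ w 0 → (a ∈ b ↔ x ∈ y)) ![t] (by
        intro a _ x _ b _ y _ hx hy
        obtain ⟨-, rfl⟩ := (hS' _ _).1 hx
        obtain ⟨-, rfl⟩ := (hS' _ _).1 hy
        exact E.j_mem_j.symm)
    exact ⟨X, hX, fun s hs => (h s hs).2⟩
  · obtain ⟨X, hX, h⟩ := E.exists_mem_measure hSP (fun _ w => ∀ a, a ∈ w 1 → ∀ x, x ∈ w 1 →
      pair a x ∈ w 0 → ∀ c, c ∈ a → ∃ z, z ∈ w 1 ∧ pair c z ∈ w 0) ![t] (by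
        intro a _ x _ hx c hc
        have hct : c ∈ t := ht a ((hS' _ _).1 hx).1 hc
        exact ⟨E.e.j c, E.j_mem_j.2 hct, (hS' _ _).2 ⟨hct, rfl⟩⟩)
    exact ⟨X, hX, fun s hs => (h s hs).2⟩
  · intro α hα
    obtain ⟨X, hX, h⟩ := E.exists_mem_measure hSP (fun _ w => ∀ ξ, ξ ∈ w 1 → pair ξ ξ ∈ w 0) ![α]
      (by
        intro ξ hξ
        change ξ ∈ E.e.j α at hξ
        rw [E.j_eq_self hα] at hξ
        obtain ⟨h₁, h₂⟩ := hfix ξ (E.crit.1.mem_trans hξ hα)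
        exact (hS' _ _).2 ⟨h₁, h₂.symm⟩)
    exact ⟨X, hX, fun s hs => (h s hs).2⟩
  · obtain ⟨X, hX, h⟩ := E.exists_mem_measure hSP (fun _ w => ∃ a, a ∈ w 1 ∧ ∃ b, b ∈ w 2 ∧
      pair a (w 1) ∈ w 0 ∧ pair b (w 3) ∈ w 0 ∧ pair a b ∈ w 4) ![κ, t, A, f]
      ⟨κ, E.crit.2.1, A, htj A hAt, (hS' _ _).2 ⟨hκt, rfl⟩, (hS' _ _).2 ⟨hAt, rfl⟩, hA⟩
    exact ⟨X, hX, fun s hs => (h s hs).2⟩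
  · intro ξ hξ hξt
    obtain ⟨X, hX, h⟩ := E.exists_mem_measure hSP (fun _ w => ∃ a, a ∈ w 1 ∧ pair a (w 2) ∈ w 0)
      ![κ, ξ] ⟨ξ, E.trans_j hξ hβ, (hS' _ _).2 ⟨hξt, rfl⟩⟩
    exact ⟨X, hX, fun s hs => (h s hs).2⟩
  · intro X
    by_cases h : S ∈ E.e.j X
    · obtain ⟨Y, hY, h'⟩ := E.exists_mem_measure hSP (fun _ w => w 0 ∈ w 1) ![X] h
      exact Or.inl ⟨Y, hY, fun s hs => (h' s hs).2⟩
    · obtain ⟨Y, hY, h'⟩ := E.exists_mem_measure hSP (fun _ w => ¬ w 0 ∈ w 1) ![X] h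
      exact Or.inr ⟨Y, hY, fun s hs => (h' s hs).2⟩
  · rintro g ⟨X, hX, h⟩
    obtain ⟨x, -, a, -, hax, hxg⟩ := (E.transfer ![X, t, g] (fun _ v => ∀ s, s ∈ v 0 → ∃ x, x ∈ v 1 ∧
      ∃ a, a ∈ v 1 ∧ pair a x ∈ s ∧ pair s x ∈ v 2)).1 h S (hU X hX).1
    obtain ⟨ha, rfl⟩ := (hS' _ _).1 hax
    obtain ⟨Y, hY, h'⟩ := E.exists_mem_measure hSP (fun _ w => pair (w 0) (w 1) ∈ w 2) ![a, g] hxg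
    exact ⟨a, ha, Y, hY, fun s hs => (h' s hs).2⟩

end SCEmb

theorem Good₀.of_eqOn {γ f f' β t A U : ZFSet.{u}}
    (h : ∀ a, a ∈ γ → ∀ b, pair a b ∈ f ↔ pair a b ∈ f') (hG : Good₀ γ f β t A U) :
    Good₀ γ f' β t A U := by
  obtain ⟨g₁, g₂, g₃, g₄, g₅, g₆, g₇, ⟨X, hX, g₈⟩, g₉⟩ := hG
  refine ⟨g₁, g₂, g₃, g₄, g₅, g₆, g₇, ⟨X, hX, fun s hs => ?_⟩, g₉⟩
  obtain ⟨a, ha, b, hb, k₁, k₂, k₃⟩ := g₈ s hs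
  exact ⟨a, ha, b, hb, k₁, k₂, (h a ha b).1 k₃⟩

theorem GoodIn.good {W γ f β t A U : ZFSet.{u}} (h : GoodIn W γ f β t A U)
    (hW₁ : ∀ X, X ⊆ powerset (prod t t) → X ∈ W)
    (hW₂ : ∀ g, g ⊆ prod (powerset (prod t t)) t → g ∈ W) : Good γ f β t A U := by
  have hP : ∀ X, X ∈ U → ∀ s, s ∈ X → s ∈ powerset (prod t t) := by
    intro X hX s hs
    refine mem_powerset.2 fun p hp => ?_
    obtain ⟨x, hx, y, hy, rfl⟩ := h.1.1 X hX s hs p hp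
    exact pair_mem_prod.2 ⟨hx, hy⟩
  refine ⟨h.1, fun X => ?_, fun g => ?_⟩
  · rcases h.2.1 _ (hW₁ (ZFSet.sep (· ∈ X) (powerset (prod t t))) (sep_subset ..)) with
      ⟨Y, hY, h'⟩ | ⟨Y, hY, h'⟩
    · exact Or.inl ⟨Y, hY, fun s hs => (mem_sep.1 (h' hs)).2⟩
    · exact Or.inr ⟨Y, hY, fun s hs hX => h' s hs (mem_sep.2 ⟨hP Y hY s hs, hX⟩)⟩
  · rintro ⟨X, hX, h'⟩
    obtain ⟨x, hx, Y, hY, h''⟩ := h.2.2 _ (hW₂ (ZFSet.sep (· ∈ g) (prod (powerset (prod t t)) t))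
      (sep_subset ..)) ⟨X, hX, fun s hs => by
        obtain ⟨x, hx, a, ha, k₁, k₂⟩ := h' s hs
        exact ⟨x, hx, a, ha, k₁, mem_sep.2 ⟨pair_mem_prod.2 ⟨hP X hX s hs, hx⟩, k₂⟩⟩⟩
    exact ⟨x, hx, Y, hY, fun s hs => (mem_sep.1 (h'' s hs)).2⟩

theorem powerset_mono' {x y : ZFSet.{u}} (h : x ⊆ y) : powerset x ⊆ powerset y := fun _ hz =>
  mem_powerset.2 ((mem_powerset.1 hz).trans h)

theorem prod_mono' {x y x' y' : ZFSet.{u}} (h : x ⊆ y) (h' : x' ⊆ y') : prod x x' ⊆ prod y y' := by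
  intro p hp
  obtain ⟨a, ha, b, hb, rfl⟩ := mem_prod.1 hp
  exact pair_mem_prod.2 ⟨h ha, h' hb⟩

theorem Supercompact.exists_good {κ f : ZFSet.{u}} (hκ : Supercompact κ) (hf : IsPFun κ f)
    (hG : Guess (V_ κ.rank) κ f) {β t A r : ZFSet.{u}} (hβ : β.IsOrdinal) (hr : RF t r β)
    (hAt : A ∈ t) (hκt : κ ∈ t) (hVt : ∀ x, x ∈ V_ κ.rank → x ∈ t) : ∃ U, Good κ f β t A U := by
  by_contra hno
  let B := V_ β.rank
  let P := powerset (powerset (powerset (prod B B)))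
  let Q := powerset (prod (powerset (prod B B)) B)
  let o := Order.succ (max (max β.rank r.rank) (max P.rank Q.rank))
  have hβo : β.rank < o := Order.lt_succ_of_le ((le_max_left _ _).trans (le_max_left _ _))
  have hro : r.rank < o := Order.lt_succ_of_le ((le_max_right _ _).trans (le_max_left _ _))
  have hPo : P.rank < o := Order.lt_succ_of_le ((le_max_left _ _).trans (le_max_right _ _))
  have hQo : Q.rank < o := Order.lt_succ_of_le ((le_max_right _ _).trans (le_max_right _ _))
  obtain ⟨θ, E, hV, ho, hM⟩ := hκ.exists_emb o
  have hβj : β ∈ E.e.j κ := by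
    refine E.trans_j ?_ ho
    rw [← hβ.toZFSet_rank_eq, Ordinal.toZFSet_mem_toZFSet_iff]
    exact hβo
  have hW : ∀ x, x.rank < o → x ∈ E.e.j (V_ κ.rank) := fun x hx => hV (mem_vonNeumann.2 hx)
  have hB : ∀ {t r β'}, RF t r β' → (β' ∈ β ∨ β' = β) → t ⊆ B := by
    intro t r β' h hle x hx
    refine mem_vonNeumann.2 ((h.rank_lt hx).trans_le ?_)
    rcases hle with h | rfl
    exacts [(rank_lt_of_mem h).le, le_rfl]
  have hBo : ∀ {t}, t ⊆ B → t.rank < o := fun h => (subset_vonNeumann.1 h).trans_lt hβo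
  have hgood : ∀ {t β' A U}, t ⊆ B → GoodIn (E.e.j (V_ κ.rank)) κ (E.e.j f) β' t A U →
      Good κ f β' t A U := by
    intro t β' A U ht h
    have h' : GoodIn (E.e.j (V_ κ.rank)) κ f β' t A U :=
      ⟨h.1.of_eqOn fun a ha b => E.pair_mem_j hf ha b, h.2⟩
    refine h'.good (fun X hX => hW X ?_) (fun g hg => hW g ?_)
    · exact (rank_mono (hX.trans (powerset_mono' (prod_mono' ht ht)))).trans_lt
        (((rank_lt_of_mem (mem_powerset.2 subset_rfl)).trans
          (rank_lt_of_mem (mem_powerset.2 subset_rfl))).trans hPo)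
    · exact (rank_lt_of_mem (mem_powerset.2 (hg.trans (prod_mono'
        (powerset_mono' (prod_mono' ht ht)) ht)))).trans hQo
  have hex : ∃ t', t' ∈ E.e.j (V_ κ.rank) ∧ ∃ A', A' ∈ E.e.j (V_ κ.rank) ∧
      Cex (E.e.j (V_ κ.rank)) κ (E.e.j f) β t' A' := by
    have ht := hB hr (Or.inr rfl)
    refine ⟨t, hW t (hBo ht), A, hW A ((rank_lt_of_mem hAt).trans (hBo ht)), ⟨r, hW r hro, hr⟩,
      hAt, hκt, ?_, fun U _ hU => hno ⟨U, hgood ht hU⟩⟩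
    rintro x - ⟨w, -, r', -, α, hα, hxw, hw⟩
    exact hVt x (mem_vonNeumann.2 ((hw.rank_lt hxw).trans (rank_lt_of_mem hα)))
  obtain ⟨β', hβ'j, hle, t', ht'W, A', hA'W, ⟨⟨r', hr'W, hr'⟩, hA't, hκt', hlow, hnot⟩, hA'f⟩ :=
    (E.transfer ![V_ κ.rank, κ, f] (fun _ v => Guess (v 0) (v 1) (v 2))).1 hG κ E.crit.2.1 β hβj hex
  have ht'B := hB hr' hle
  have hκr : κ.rank < o := (rank_lt_of_mem (ht'B hκt')).trans
    ((rank_vonNeumann β.rank).trans_lt hβo)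
  have hVt' : ∀ x, x ∈ V_ κ.rank → x ∈ t' := by
    intro x hx
    rw [mem_vonNeumann] at hx
    have hxκ : x.rank.toZFSet ∈ κ := by
      rwa [← E.crit.1.toZFSet_rank_eq, Ordinal.toZFSet_mem_toZFSet_iff]
    obtain ⟨α, hα, hxα⟩ := E.exists_gt hxκ
    have hαB : V_ α.rank ⊆ B := vonNeumann_subset_of_le
      ((rank_lt_of_mem hα).trans (mem_vonNeumann.1 (ht'B hκt'))).le
    refine hlow x (hW x (hx.trans hκr)) ⟨V_ α.rank, hW _ (hBo hαB), rankFn α.rank, hW _ ?_, α, hα,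
      mem_vonNeumann.2 (by simpa using rank_lt_of_mem hxα), ?_⟩
    · have hsub : α.rank.toZFSet ⊆ V_ α.rank := subset_vonNeumann.2 (by simp)
      exact (rank_mono ((sep_subset ..).trans (prod_mono' hαB (hsub.trans hαB)))).trans_lt
        (((rank_lt_of_mem (mem_powerset.2 subset_rfl)).trans ((rank_lt_of_mem
          (mem_powerset.2 subset_rfl)).trans (rank_lt_of_mem (mem_powerset.2 subset_rfl)))).trans hPo)
    · simpa only [(E.crit.1.mem hα).toZFSet_rank_eq] using rf_vonNeumann α.rank
  obtain ⟨S, hS, hSc⟩ := exists_graph t' E.e.j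
  have hjWM : ∀ x, x ∈ E.e.j (V_ κ.rank) → x ∈ E.M := E.trans _ (E.j_mem _)
  have ht'M : ∀ x, x ∈ t' → x ∈ E.M := E.trans _ (hjWM t' ht'W)
  have htj : ∀ x, x ∈ t' → x ∈ E.e.j t' := fun x hx =>
    E.j_subset (fun x hx => hVt' x hx) (hW x ((rank_lt_of_mem hx).trans (hBo ht'B)))
  have hSM : S ∈ E.M := by
    refine hM S (fun p hp => ?_) (hSc.trans ?_)
    · obtain ⟨x, hx, rfl⟩ := (hS p).1 hp
      exact E.pair_mem (ht'M x hx) (E.j_mem x)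
    · rw [mk_toSet, mk_toSet, Cardinal.lift_le]
      exact card_mono (ht'B.trans (vonNeumann_subset_of_le hβo.le))
  have hgoodU := E.good_of_graph hS hSM (fun x hx y hy => hr'.1 x hx y hy) hVt' htj hκt' hA't hβ'j
    hA'f
  refine hnot _ (hW _ ?_) ⟨hgoodU.1.of_eqOn fun a ha b => (E.pair_mem_j hf ha b).symm,
    fun X _ => hgoodU.2.1 X, fun g _ => hgoodU.2.2 g⟩
  exact (rank_lt_of_mem (mem_powerset.2 ((sep_subset ..).trans (powerset_mono'
    (powerset_mono' (prod_mono' ht'B ht'B)))))).trans hPo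

end LaverDiamond
namespace LaverDiamond

open ZFSet Filter

/-- The membership relation of a structure in the language of set theory. -/
def structMem {P : Type*} [SetLang.Structure P] (x y : P) : Prop :=
  Language.Structure.RelMap memSym ![x, y]

theorem exists_collapse {P : Type (u + 1)} [SetLang.Structure P]
    (hwf : WellFounded (structMem : P → P → Prop))
    (hsmall : ∀ x : P, Small.{u} {y : P // structMem y x})
    (hext : ∀ x y : P, (∀ z, structMem z x ↔ structMem z y) → x = y) :
    ∃ π : P → ZFSet.{u}, Function.Injective π ∧ (∀ x z, z ∈ π x ↔ ∃ y, structMem y x ∧ π y = z) ∧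
      ∀ {n : ℕ} (φ : SetLang.Formula (Fin n)) (v : Fin n → P),
        φ.Realize (fun i => (⟨π (v i), Set.mem_range_self _⟩ : Set.range π)) ↔ φ.Realize v := by
  let π : P → ZFSet.{u} := hwf.fix fun x F =>
    have := hsmall x
    ZFSet.range fun y : {y : P // structMem y x} => F y.1 y.2
  have hπ : ∀ x z, z ∈ π x ↔ ∃ y, structMem y x ∧ π y = z := by
    intro x z
    have := hsmall x
    rw [show π x = ZFSet.range fun y : {y : P // structMem y x} => π y.1 from hwf.fix_eq _ x,
      mem_range]
    exact ⟨fun ⟨y, h⟩ => ⟨y.1, y.2, h⟩, fun ⟨y, hy, h⟩ => ⟨⟨y, hy⟩, h⟩⟩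
  have hinj : Function.Injective π := by
    intro x
    induction x using hwf.induction with
    | _ x ih =>
      intro y hxy
      refine hext x y fun z => ⟨fun hz => ?_, fun hz => ?_⟩
      · obtain ⟨w, hw, e⟩ := (hπ y (π z)).1 (hxy ▸ (hπ x _).2 ⟨z, hz, rfl⟩)
        exact ih z hz e.symm ▸ hw
      · obtain ⟨w, hw, e⟩ := (hπ x (π z)).1 (hxy ▸ (hπ y _).2 ⟨z, hz, rfl⟩)
        exact ih w hw e ▸ hw
  have hmem : ∀ x y, π x ∈ π y ↔ structMem x y := by
    intro x y
    rw [hπ]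
    exact ⟨fun ⟨z, hz, e⟩ => hinj e ▸ hz, fun h => ⟨x, h, rfl⟩⟩
  refine ⟨π, hinj, hπ, fun φ v => ?_⟩
  let e : P ≃[SetLang] Set.range π :=
    { Equiv.ofInjective π hinj with
      map_fun' := fun {n} f => Empty.elim f
      map_rel' := fun {n} r x => by
        cases r
        have hx : x = ![x 0, x 1] := by
          funext i
          refine Fin.cases rfl (fun i => ?_) i
          rw [Subsingleton.elim i 0]
          rfl
        refine (hmem (x 0) (x 1)).trans ?_
        rw [structMem, ← hx]
        rfl }
  exact Language.StrongHomClass.realize_formula e φ (v := v)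

/-- The constant-free form of Łoś's theorem for a collapsed ultrapower of the universe. -/
theorem exists_ultrapower {I : Type (u + 1)} [Small.{u} I] (U : Ultrafilter I)
    [CountableInterFilter (U : Filter I)] :
    ∃ c : (I → ZFSet.{u}) → ZFSet.{u}, TransClass (Set.range c) ∧
      ∀ {n : ℕ} (φ : SetLang.Formula (Fin n)) (g : Fin n → I → ZFSet.{u}),
        φ.Realize (fun i => (⟨c (g i), Set.mem_range_self _⟩ : Set.range c)) ↔
          ∀ᶠ s in U, φ.Realize (fun i => (⟨g i s, trivial⟩ : V.{u})) := by
  let P := (U : Filter I).Product (fun _ => V.{u})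
  let q : (I → ZFSet.{u}) → P := fun g => ((fun s => ⟨g s, trivial⟩ : I → V.{u}) : P)
  have hq : ∀ x : P, ∃ g, q g = x := fun x => by
    obtain ⟨g, rfl⟩ := Quotient.exists_rep x
    exact ⟨fun s => (g s).1, rfl⟩
  have : Nonempty V.{u} := ⟨⟨∅, trivial⟩⟩
  have hlos : ∀ {n : ℕ} (φ : SetLang.Formula (Fin n)) (g : Fin n → I → ZFSet.{u}),
      φ.Realize (fun i => q (g i)) ↔ ∀ᶠ s in U, φ.Realize (fun i => (⟨g i s, trivial⟩ : V.{u})) :=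
    fun φ g => Language.Ultraproduct.realize_formula_cast φ _
  have hmem : ∀ g h, structMem (q g) (q h) ↔ ∀ᶠ s in U, g s ∈ h s := by
    intro g h
    have := hlos (Language.Relations.formula memSym
      ![Language.Term.var 0, Language.Term.var 1]) ![g, h]
    simp only [Language.Formula.realize_rel, relMap_memSym] at this
    refine Iff.trans (iff_of_eq ?_) this
    rw [structMem]
    congr 1
    funext i
    refine Fin.cases rfl (fun i => ?_) i
    rw [Subsingleton.elim i 0]
    rfl
  have heq : ∀ g h, q g = q h ↔ ∀ᶠ s in U, g s = h s := by
    intro g h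
    refine Quotient.eq''.trans (eventually_congr (Eventually.of_forall fun s => ?_))
    exact Subtype.mk_eq_mk
  have hwf : WellFounded (structMem : P → P → Prop) := by
    rw [wellFounded_iff_isEmpty_descending_chain]
    refine ⟨fun ⟨x, hx⟩ => ?_⟩
    choose g hg using fun n => hq (x n)
    have h₁ : ∀ᶠ s in U, ∀ n, g (n + 1) s ∈ g n s := by
      refine eventually_countable_forall.2 fun n => (hmem _ _).1 ?_
      rw [hg, hg]
      exact hx n
    obtain ⟨s, hs⟩ := h₁.exists
    exact (wellFounded_iff_isEmpty_descending_chain.1 ZFSet.mem_wf).elim ⟨fun n => g n s, hs⟩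
  have hsmall : ∀ x : P, Small.{u} {y : P // structMem y x} := by
    intro x
    obtain ⟨g, rfl⟩ := hq x
    let F : (∀ s : I, ↥(insert ∅ (g s) : ZFSet.{u})) → P := fun h => q fun s => (h s).1
    refine small_subset (s := Set.range F) (t := {y | structMem y (q g)}) ?_
    intro y hy
    obtain ⟨h, rfl⟩ := hq y
    have hh := (hmem h g).1 hy
    classical
    refine ⟨fun s => if hs : h s ∈ g s then ⟨h s, mem_insert_of_mem _ hs⟩
      else ⟨∅, mem_insert _ _⟩, ?_⟩
    refine (heq _ _).2 (hh.mono fun s hs => ?_)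
    simp [hs]
  have hext : ∀ x y : P, (∀ z, structMem z x ↔ structMem z y) → x = y := by
    intro x y hxy
    obtain ⟨g, rfl⟩ := hq x
    obtain ⟨h, rfl⟩ := hq y
    have key : ∀ g h : I → ZFSet.{u}, (∀ z, structMem z (q g) → structMem z (q h)) →
        ∀ᶠ s in U, g s ⊆ h s := by
      intro g h hgh
      by_contra hno
      rw [← Ultrafilter.eventually_not] at hno
      have hex : ∀ s, ∃ z, ¬ g s ⊆ h s → z ∈ g s ∧ ¬ z ∈ h s := by
        intro s
        by_cases hs : g s ⊆ h s
        · exact ⟨∅, fun h => absurd hs h⟩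
        · rw [ZFSet.subset_def] at hs
          push Not at hs
          obtain ⟨z, hz⟩ := hs
          exact ⟨z, fun _ => hz⟩
      choose z hz using hex
      have h₁ := (hmem z h).1 (hgh _ ((hmem z g).2 (hno.mono fun s hs => (hz s hs).1)))
      obtain ⟨s, hs, hs'⟩ := (h₁.and hno).exists
      exact (hz s hs').2 hs
    rw [heq]
    filter_upwards [key g h fun z => (hxy z).1, key h g fun z => (hxy z).2] with s h₁ h₂
    exact subset_antisymm h₁ h₂
  obtain ⟨π, hinj, hπ, hφ⟩ := exists_collapse hwf hsmall hext
  have hrange : Set.range (fun g => π (q g)) = Set.range π :=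
    Function.Surjective.range_comp hq π
  refine ⟨fun g => π (q g), ?_, fun φ g => ?_⟩
  · rintro _ ⟨g, rfl⟩ z hz
    obtain ⟨y, -, rfl⟩ := (hπ _ _).1 hz
    obtain ⟨h, rfl⟩ := hq y
    exact ⟨h, rfl⟩
  · rw [← hlos φ g, ← hφ φ fun i => q (g i)]
    have aux : ∀ (N : Set ZFSet.{u}) (hN : Set.range π = N) (h : ∀ i, π (q (g i)) ∈ N),
        φ.Realize (fun i => (⟨π (q (g i)), h i⟩ : N)) ↔
        φ.Realize (fun i => (⟨π (q (g i)), Set.mem_range_self _⟩ : Set.range π)) := by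
      rintro N rfl h
      exact Iff.rfl
    exact aux _ hrange.symm _

end LaverDiamond
namespace LaverDiamond

open ZFSet Filter

theorem SCEmb.natCast_mem {κ θ : ZFSet.{u}} (E : SCEmb κ θ) :
    ∃ α, α ∈ κ ∧ ∀ n : ℕ, (n : Ordinal.{u}).toZFSet ∈ α := by
  suffices h : Ordinal.omega0.toZFSet ∈ κ from
    ⟨_, h, fun n => Ordinal.toZFSet_mem_toZFSet_iff.2 (Ordinal.natCast_lt_omega0 n)⟩
  by_contra hω
  rw [← E.crit.1.toZFSet_rank_eq, Ordinal.toZFSet_mem_toZFSet_iff, not_lt] at hω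
  have h₁ : ∀ x, x ∈ κ → (∀ y, y ∈ x → ¬ y = y) ∨ ∃ y, y ∈ x ∧ ∀ z, z ∈ x → z ∈ y ∨ z = y := by
    intro x hx
    have hxo := (E.crit.1.mem hx).toZFSet_rank_eq
    obtain ⟨n, hn⟩ := Ordinal.lt_omega0.1 ((rank_lt_of_mem hx).trans_le hω)
    rw [hn] at hxo
    subst hxo
    rcases n with _ | n
    · exact Or.inl fun y hy => by simp at hy
    · refine Or.inr ⟨(n : Ordinal.{u}).toZFSet, by simp, fun z hz => ?_⟩
      obtain ⟨b, hb, rfl⟩ := Ordinal.mem_toZFSet_iff.1 hz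
      rw [Nat.cast_succ, Order.lt_add_one_iff, le_iff_lt_or_eq] at hb
      exact hb.imp Ordinal.toZFSet_mem_toZFSet_iff.2 (by rintro rfl; rfl)
  rcases (E.transfer ![κ] (fun _ v => ∀ x, x ∈ v 0 → (∀ y, y ∈ x → ¬ y = y) ∨
    ∃ y, y ∈ x ∧ ∀ z, z ∈ x → z ∈ y ∨ z = y)).1 h₁ κ E.crit.2.1 with h | ⟨y, hy, h⟩
  · exact (E.transfer ![κ] (fun _ v => ∀ y, y ∈ v 0 → ¬ y = y)).1 h κ E.crit.2.1 rfl
  · obtain ⟨z, hz, hyz⟩ := E.exists_gt hy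
    rcases h z hz with h' | rfl
    exacts [mem_asymm h' hyz, mem_irrefl _ hyz]

/-- The binary relations on `t`. -/
abbrev Idx (t : ZFSet.{u}) : Type (u + 1) := powerset (prod t t)

/-- `U` is the ultrafilter generated by a Laver measure. -/
structure IsLaver (κ f β t A : ZFSet.{u}) (U : Ultrafilter (Idx t)) : Prop where
  fine : ∀ x, x ∈ t → ∀ᶠ s in (U : Filter (Idx t)), ∃ a, a ∈ t ∧ pair a x ∈ s.1
  iso : ∀ᶠ s in (U : Filter (Idx t)), ∀ a, a ∈ t → ∀ x, x ∈ t → ∀ b, b ∈ t → ∀ y, y ∈ t →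
    pair a x ∈ s.1 → pair b y ∈ s.1 → (a ∈ b ↔ x ∈ y)
  down : ∀ᶠ s in (U : Filter (Idx t)), ∀ a, a ∈ t → ∀ x, x ∈ t → pair a x ∈ s.1 →
    ∀ c, c ∈ a → ∃ z, z ∈ t ∧ pair c z ∈ s.1
  fixed : ∀ α, α ∈ κ → ∀ᶠ s in (U : Filter (Idx t)), ∀ ξ, ξ ∈ α → pair ξ ξ ∈ s.1
  hits : ∀ᶠ s in (U : Filter (Idx t)), ∃ a, a ∈ κ ∧ ∃ b, b ∈ t ∧ pair a κ ∈ s.1 ∧ pair b A ∈ s.1 ∧ pair a b ∈ f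
  big : ∀ ξ, ξ ∈ β → ξ ∈ t → ∀ᶠ s in (U : Filter (Idx t)), ∃ a, a ∈ κ ∧ pair a ξ ∈ s.1
  normal : ∀ R : Idx t → ZFSet.{u} → Prop,
    (∀ᶠ s in (U : Filter (Idx t)), ∃ x, x ∈ t ∧ ∃ a, a ∈ t ∧ pair a x ∈ s.1 ∧ R s x) →
      ∃ x, x ∈ t ∧ ∀ᶠ s in (U : Filter (Idx t)), R s x

theorem Good.exists_isLaver {κ f β t A U : ZFSet.{u}} (h : Good κ f β t A U) :
    ∃ U', IsLaver κ f β t A U' := by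
  obtain ⟨⟨hrel, hne, hinter, hfine, hiso, hdown, hfixed, hhits, hbig⟩, hdec, hnorm⟩ := h
  let I := powerset (prod t t)
  have hI : ∀ X, X ∈ U → ∀ s, s ∈ X → s ∈ I := by
    intro X hX s hs
    refine mem_powerset.2 fun p hp => ?_
    obtain ⟨x, hx, y, hy, rfl⟩ := hrel X hX s hs p hp
    exact pair_mem_prod.2 ⟨hx, hy⟩
  let F : Filter I :=
    { sets := {S | ∃ X, X ∈ U ∧ ∀ s : I, s.1 ∈ X → s ∈ S}
      univ_sets := by
        obtain ⟨X, hX, -⟩ := hiso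
        exact ⟨X, hX, fun _ _ => trivial⟩
      sets_of_superset := fun ⟨X, hX, h⟩ hST => ⟨X, hX, fun s hs => hST (h s hs)⟩
      inter_sets := fun ⟨X, hX, h⟩ ⟨Y, hY, h'⟩ => by
        obtain ⟨Z, hZ, h₁, h₂⟩ := hinter X hX Y hY
        exact ⟨Z, hZ, fun s hs => ⟨h s (h₁ hs), h' s (h₂ hs)⟩⟩ }
  have hF : ∀ S, S ∈ F ↔ ∃ X, X ∈ U ∧ ∀ s : I, s.1 ∈ X → s ∈ S := fun S => Iff.rfl
  have hex : ∀ S, S ∈ F → ∃ s, s ∈ S := by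
    rintro S ⟨X, hX, h⟩
    obtain ⟨s, hs, -⟩ := hne X hX
    exact ⟨⟨s, hI X hX s hs⟩, h _ hs⟩
  let U' : Ultrafilter I := Ultrafilter.ofComplNotMemIff F fun S => by
    constructor
    · intro hS
      rcases hdec (ZFSet.sep (fun s => ∃ h : s ∈ I, (⟨s, h⟩ : I) ∈ S) I) with
        ⟨Y, hY, h⟩ | ⟨Y, hY, h⟩
      · refine ⟨Y, hY, fun s hs => ?_⟩
        obtain ⟨h, h'⟩ := (mem_sep.1 (h hs)).2
        exact h'
      · refine absurd ⟨Y, hY, fun s hs hsS => ?_⟩ hS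
        exact h s.1 hs (mem_sep.2 ⟨s.2, s.2, hsS⟩)
    · intro hS hS'
      obtain ⟨s, hs, hs'⟩ := hex _ (F.inter_sets hS hS')
      exact hs' hs
  have hU : ∀ P : I → Prop, (∀ᶠ s in (U' : Filter I), P s) ↔
      ∃ X, X ∈ U ∧ ∀ s : I, s.1 ∈ X → P s := fun P => Iff.rfl
  have hU' : ∀ P : ZFSet.{u} → Prop, (∃ X, X ∈ U ∧ ∀ s, s ∈ X → P s) →
      ∀ᶠ s : I in (U' : Filter I), P s.1 := fun P ⟨X, hX, h⟩ => ⟨X, hX, fun s hs => h s.1 hs⟩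
  refine ⟨U', fun x hx => hU' _ (hfine x hx), hU' _ hiso, hU' _ hdown, fun α hα => hU' _ (hfixed α hα),
    hU' _ hhits, fun ξ hξ hξt => hU' _ (hbig ξ hξ hξt), fun R hR => ?_⟩
  obtain ⟨X, hX, h⟩ := (hU _).1 hR
  obtain ⟨x, hx, Y, hY, h'⟩ := hnorm
    (ZFSet.sep (fun p => ∃ s : I, ∃ x, p = pair s.1 x ∧ R s x) (prod I t)) ⟨X, hX, fun s hs => by
      obtain ⟨x, hx, a, ha, hax, hR⟩ := h ⟨s, hI X hX s hs⟩ hs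
      exact ⟨x, hx, a, ha, hax, mem_sep.2 ⟨pair_mem_prod.2 ⟨hI X hX s hs, hx⟩, _, x, rfl, hR⟩⟩⟩
  refine ⟨x, hx, (hU _).2 ⟨Y, hY, fun s hs => ?_⟩⟩
  obtain ⟨s', x', e, hR⟩ := (mem_sep.1 (h' s.1 hs)).2
  obtain ⟨e₁, rfl⟩ := pair_inj.1 e
  rwa [Subtype.ext e₁]

namespace IsLaver

variable {κ f β t A : ZFSet.{u}} {U : Ultrafilter (Idx t)}

theorem countableInter (h : IsLaver κ f β t A U)
    (hω : ∃ α, α ∈ κ ∧ ∀ n : ℕ, (n : Ordinal.{u}).toZFSet ∈ α)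
    (hκt : ∀ x, x ∈ κ → x ∈ t) (hκ : κ.IsOrdinal) :
    CountableInterFilter (U : Filter (Idx t)) := by
  suffices hall : ∀ P : ℕ → Idx t → Prop, (∀ n, ∀ᶠ s in (U : Filter (Idx t)), P n s) →
      ∀ᶠ s in (U : Filter (Idx t)), ∀ n, P n s by
    refine ⟨fun S hS hSU => ?_⟩
    rcases S.eq_empty_or_nonempty with rfl | hne
    · simp
    · obtain ⟨e, rfl⟩ := hS.exists_eq_range hne
      rw [Set.sInter_range]
      refine (hall (fun n s => s ∈ e n) fun n => hSU _ (Set.mem_range_self n)).mono fun s hs => ?_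
      exact Set.mem_iInter.2 hs
  intro P hP
  obtain ⟨α, hα, hn⟩ := hω
  by_contra hno
  rw [← Ultrafilter.eventually_not] at hno
  obtain ⟨x, hx, hx'⟩ := h.normal
    (fun s x => ∃ n : ℕ, x = (n : Ordinal.{u}).toZFSet ∧ ¬ P n s) (by
      filter_upwards [hno, h.fixed α hα] with s hs hfix
      push Not at hs
      obtain ⟨n, hns⟩ := hs
      have hnt := hκt _ (hκ.mem_trans (hn n) hα)
      exact ⟨_, hnt, _, hnt, hfix _ (hn n), n, rfl, hns⟩)
  obtain ⟨s, n, rfl, -⟩ := hx'.exists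
  obtain ⟨s, hs, m, hmn, hs'⟩ := ((hP n).and hx').exists
  rw [Ordinal.toZFSet_injective.eq_iff, Nat.cast_inj] at hmn
  exact hs' (hmn ▸ hs)

theorem exists_emb {θ : ZFSet.{u}} (h : IsLaver κ f β t A U) (hκ : κ.IsOrdinal)
    (hω : ∃ α, α ∈ κ ∧ ∀ n : ℕ, (n : Ordinal.{u}).toZFSet ∈ α)
    (hlim : ∀ α, α ∈ κ → ∃ α', α' ∈ κ ∧ α ∈ α') (ht : t.IsTransitive) (hκt : κ ∈ t) (hAt : A ∈ t)
    (hθ : θ ∈ β) (hθt : θ ∈ t) : ∃ E : SCEmb κ θ, pair κ A ∈ E.e.j f := by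
  have := h.countableInter hω (fun x hx => ht κ hκt hx) hκ
  obtain ⟨c, htr, hlos⟩ := exists_ultrapower U
  have hdef : ∀ {n : ℕ} (Q : Set ZFSet.{u} → (Fin n → ZFSet.{u}) → Prop) [Def Q]
      (g : Fin n → Idx t → ZFSet.{u}),
      Q (Set.range c) (fun i => c (g i)) ↔ ∀ᶠ s in (U : Filter (Idx t)), Q V (fun i => g i s) := by
    intro n Q hQ g
    obtain ⟨φ, hφ⟩ := hQ.out
    rw [← hφ _ htr _ (fun i => Set.mem_range_self _), hlos]
    refine eventually_congr (Eventually.of_forall fun s => ?_)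
    exact hφ V transClass_V _ _
  have hmem : ∀ g h, c g ∈ c h ↔ ∀ᶠ s in (U : Filter (Idx t)), g s ∈ h s := fun g h =>
    hdef (fun _ v => v 0 ∈ v 1) ![g, h]
  have heq : ∀ g h, c g = c h ↔ ∀ᶠ s in (U : Filter (Idx t)), g s = h s := fun g h =>
    hdef (fun _ v => v 0 = v 1) ![g, h]
  have hpair : ∀ g h, c (fun s => pair (g s) (h s)) = pair (c g) (c h) := fun g h =>
    (hdef (n := 3) (fun _ v => v 2 = pair (v 0) (v 1)) ![g, h, fun s => pair (g s) (h s)]).2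
      (Eventually.of_forall fun _ => rfl)
  have hex : ∀ s : Idx t, ∀ z, ∃ a, (∃ a, a ∈ t ∧ pair a z ∈ s.1) →
      a ∈ t ∧ pair a z ∈ s.1 := by
    intro s z
    by_cases hs : ∃ a, a ∈ t ∧ pair a z ∈ s.1
    · exact ⟨hs.choose, fun _ => hs.choose_spec⟩
    · exact ⟨∅, fun h => absurd h hs⟩
  choose k₀ hk₀ using hex
  have hid : ∀ x, x ∈ t → ∀ k, (∀ᶠ s in (U : Filter (Idx t)), k s ∈ t ∧ pair (k s) x ∈ s.1) → c k = x := by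
    intro x
    induction x using ZFSet.inductionOn with
    | _ x ih =>
      intro hx k hk
      ext z
      constructor
      · intro hz
        obtain ⟨g, rfl⟩ := htr _ (Set.mem_range_self k) z hz
        have hg := (hmem g k).1 hz
        obtain ⟨w, hw, hgw⟩ := h.normal (fun s w => w ∈ x ∧ g s ∈ t ∧ pair (g s) w ∈ s.1) (by
          filter_upwards [hk, hg, h.down, h.iso] with s ⟨hs₁, hs₂⟩ hs₃ hdown hiso
          obtain ⟨w, hw, hgw⟩ := hdown _ hs₁ x hx hs₂ _ hs₃
          have hgt := ht _ hs₁ hs₃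
          exact ⟨w, hw, _, hgt, hgw, (hiso _ hgt w hw _ hs₁ x hx hgw hs₂).1 hs₃, hgt, hgw⟩)
        obtain ⟨s, hs⟩ := hgw.exists
        rw [ih w hs.1 hw g (hgw.mono fun s hs => hs.2)]
        exact hs.1
      · intro hz
        have hzt := ht x hx hz
        have hgz := (h.fine z hzt).mono fun s => hk₀ s z
        rw [← ih z hz hzt _ hgz, hmem]
        filter_upwards [hk, hgz, h.iso] with s ⟨hs₁, hs₂⟩ ⟨hs₃, hs₄⟩ hiso
        exact (hiso _ hs₃ z hzt _ hs₁ x hx hs₄ hs₂).2 hz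
  have hk₀id : ∀ x, x ∈ t → c (fun s => k₀ s x) = x := fun x hx =>
    hid x hx _ ((h.fine x hx).mono fun s => hk₀ s x)
  let e : ClassEmb V.{u} (Set.range c) :=
    { j := fun x => c fun _ => x
      maps := fun x _ => Set.mem_range_self _
      elem := fun φ v _ => by
        refine Iff.trans ?_ (hlos φ fun i _ => v i).symm
        rw [eventually_const] }
  have hκsub : ∀ x, x ∈ κ → x ∈ t := fun x hx => ht κ hκt hx
  have hfixed : ∀ α, α ∈ κ → e.j α = α := by
    intro α hα
    obtain ⟨α', hα', hαα'⟩ := hlim α hα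
    exact hid α (hκsub α hα) _ ((h.fixed α' hα').mono fun s hs => ⟨hκsub α hα, hs α hαα'⟩)
  have hbelow : ∀ ξ, ξ ∈ t → (∀ᶠ s in (U : Filter (Idx t)), ∃ a, a ∈ κ ∧ pair a ξ ∈ s.1) →
      ξ ∈ e.j κ := by
    intro ξ hξ hs
    obtain ⟨g, hg⟩ := hs.choice
    rw [← hid ξ hξ g (hg.mono fun s hs => ⟨hκsub _ hs.1, hs.2⟩)]
    exact (hmem _ _).2 (hg.mono fun s hs => hs.1)
  refine ⟨⟨Set.range c, htr, e, ⟨hκ, ?_, fun α _ => hfixed α⟩, ?_, hbelow θ hθt (h.big θ hθ hθt)⟩, ?_⟩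
  · exact hbelow κ hκt (h.hits.mono fun s ⟨a, ha, _, _, hs, _⟩ => ⟨a, ha, hs⟩)
  · intro F hF
    have hFv : ∀ a, ∃ g, a ∈ θ → pair a (c g) ∈ F := by
      intro a
      by_cases ha : a ∈ θ
      · obtain ⟨b, hb, -⟩ := hF.2 a ha
        obtain ⟨a', b', -, ⟨g, rfl⟩, e⟩ := hF.1 _ hb
        obtain ⟨rfl, rfl⟩ := pair_inj.1 e
        exact ⟨g, fun _ => hb⟩
      · exact ⟨fun _ => ∅, fun h => absurd h ha⟩
    choose g hg using hFv
    let G : Idx t → ZFSet.{u} := fun s =>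
      ZFSet.range fun p : {p : ↥t × ↥θ // pair p.1.1 p.2.1 ∈ s.1} => pair p.1.1 (g p.1.2 s)
    have hG : ∀ s z, z ∈ G s ↔ ∃ x, x ∈ θ ∧ ∃ a, a ∈ t ∧ pair a x ∈ s.1 ∧ z = pair a (g x s) := by
      intro s z
      simp only [G, mem_range]
      constructor
      · rintro ⟨⟨⟨a, x⟩, hp⟩, rfl⟩
        exact ⟨x, x.2, a, a.2, hp, rfl⟩
      · rintro ⟨x, hx, a, ha, hp, rfl⟩
        exact ⟨⟨⟨⟨a, ha⟩, ⟨x, hx⟩⟩, hp⟩, rfl⟩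
    refine ⟨G, ?_⟩
    ext z
    constructor
    · intro hz
      obtain ⟨k, rfl⟩ := htr _ (Set.mem_range_self G) z hz
      obtain ⟨x, hx, hx'⟩ := h.normal (fun s x => x ∈ θ ∧ ∃ a, a ∈ t ∧ pair a x ∈ s.1 ∧
        k s = pair a (g x s)) (((hmem k G).1 hz).mono fun s hs => by
          obtain ⟨x, hx, a, ha, hax, hs⟩ := (hG _ _).1 hs
          exact ⟨x, ht θ hθt hx, a, ha, hax, hx, a, ha, hax, hs⟩)
      obtain ⟨s, hs, -⟩ := hx'.exists
      obtain ⟨l, hl⟩ := (hx'.mono fun s hs => hs.2).choice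
      have : c k = pair (c l) (c (g x)) := by
        rw [← hpair, heq]
        exact hl.mono fun s hs => hs.2.2
      rw [this, hid x hx l (hl.mono fun s hs => ⟨hs.1, hs.2.1⟩)]
      exact hg x hs
    · intro hz
      obtain ⟨x, b, hx, -, rfl⟩ := hF.1 z hz
      obtain rfl := (hF.2 x hx).unique hz (hg x hx)
      have hxt := ht θ hθt hx
      rw [← congrArg (fun y => pair y (c (g x))) (hk₀id x hxt), ← hpair, hmem]
      filter_upwards [h.fine x hxt] with s hs
      exact (hG _ _).2 ⟨x, hx, _, (hk₀ s x hs).1, (hk₀ s x hs).2, rfl⟩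
  · obtain ⟨a, ha⟩ := h.hits.choice
    obtain ⟨b, hb⟩ := (ha.mono fun s hs => hs.2).choice
    have h₁ : c a = κ := hid κ hκt a ((ha.and hb).mono fun s hs => ⟨hκsub _ hs.1.1, hs.2.2.1⟩)
    have h₂ : c b = A := hid A hAt b (hb.mono fun s hs => ⟨hs.1, hs.2.2.1⟩)
    have hmem' : pair (c a) (c b) ∈ c fun _ => f := by
      rw [← hpair]
      exact (hmem _ _).2 (hb.mono fun s hs => hs.2.2.2)
    rwa [h₁, h₂] at hmem'

end IsLaver

end LaverDiamond
namespace LaverDiamond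

open ZFSet

/-- **Laver's theorem**: the Laver diamond holds at every supercompact cardinal. -/
theorem Supercompact.exists_LDscFun {κ : ZFSet.{u}} (hκ : Supercompact κ) : ∃ f, LDscFun κ f := by
  obtain ⟨f, hf, hG⟩ := exists_guess hκ.isOrdinal
  refine ⟨f, hf, fun θ A hθ _ => ?_⟩
  let o := Order.succ (max (rank κ) (max (rank θ) (rank A)))
  have hκo : rank κ < o := Order.lt_succ_of_le (le_max_left _ _)
  have hθo : rank θ < o := Order.lt_succ_of_le ((le_max_left _ _).trans (le_max_right _ _))
  have hAo : rank A < o := Order.lt_succ_of_le ((le_max_right _ _).trans (le_max_right _ _))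
  obtain ⟨U, hU⟩ := hκ.exists_good hf hG (isOrdinal_toZFSet o) (rf_vonNeumann o)
    (mem_vonNeumann.2 hAo) (mem_vonNeumann.2 hκo) fun x hx => vonNeumann_subset_of_le hκo.le hx
  obtain ⟨U', hU'⟩ := hU.exists_isLaver
  obtain ⟨θ₀, E, -⟩ := hκ.exists_emb 0
  refine hU'.exists_emb hκ.isOrdinal E.natCast_mem (fun α hα => E.exists_gt hα)
    (isTransitive_vonNeumann o) (mem_vonNeumann.2 hκo) (mem_vonNeumann.2 hAo) ?_
    (mem_vonNeumann.2 hθo)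
  rw [← hθ.1.toZFSet_rank_eq]
  exact Ordinal.toZFSet_mem_toZFSet_iff.2 hθo

/-- Amalgamating Laver functions: on the ordinals `γ` that are not limits of `S`, follow the Laver
function of the least element of `S` above `γ`. -/
theorem exists_amalgam {κ S : ZFSet.{u}} (hκ : κ.IsOrdinal) (hS : S ⊆ κ) (F : ZFSet.{u} → ZFSet.{u})
    (hF : ∀ δ, δ ∈ S → LDscFun δ (F δ))
    (hbdd : ∀ δ, δ ∈ S → ∃ α, α ∈ δ ∧ ∀ δ', δ' ∈ S → δ' ∈ δ → ¬ α ∈ δ') :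
    ∃ ℓ, IsPFun κ ℓ ∧ (∀ δ, δ ∈ S → ∃ r, RestrictSet ℓ δ r ∧ LDscFun δ r) ∧
      ∀ γ A, pair γ A ∈ ℓ → ∃ ξ, ξ ∈ γ ∧ ∀ δ, δ ∈ S → δ ∈ γ → ¬ ξ ∈ δ := by
  let Nxt := fun γ δ : ZFSet.{u} => δ ∈ S ∧ γ ∈ δ ∧ ∀ δ', δ' ∈ S → γ ∈ δ' → ¬ δ' ∈ δ
  have hNxt : ∀ {γ δ δ'}, Nxt γ δ → Nxt γ δ' → δ = δ' := by
    intro γ δ δ' h h'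
    rcases (hκ.mem (hS h.1)).mem_trichotomous (hκ.mem (hS h'.1)) with hlt | heq | hlt
    · exact absurd hlt (h'.2.2 δ h.1 h.2.1)
    · exact heq
    · exact absurd hlt (h.2.2 δ' h'.1 h'.2.1)
  let P := fun γ A : ZFSet.{u} => (∃ ξ, ξ ∈ γ ∧ ∀ δ, δ ∈ S → δ ∈ γ → ¬ ξ ∈ δ) ∧
    ∃ δ, Nxt γ δ ∧ pair γ A ∈ F δ
  have hmemF : ∀ {δ γ A}, δ ∈ S → pair γ A ∈ F δ → γ ∈ δ ∧ MemV δ A := by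
    intro δ γ A hδ h
    obtain ⟨γ', A', h₁, h₂, e⟩ := (hF δ hδ).1.1 _ h
    obtain ⟨rfl, rfl⟩ := pair_inj.1 e
    exact ⟨h₁, h₂⟩
  have hrank : ∀ {δ}, δ ∈ S → rank δ ≤ rank κ := fun hδ => (rank_lt_of_mem (hS hδ)).le
  let ℓ := ZFSet.sep (fun p => ∃ γ A, p = pair γ A ∧ P γ A) (prod κ (V_ (rank κ)))
  have hℓ : ∀ γ A, pair γ A ∈ ℓ ↔ P γ A := by
    intro γ A
    refine mem_sep.trans ⟨?_, fun h => ⟨?_, γ, A, rfl, h⟩⟩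
    · rintro ⟨-, γ', A', e, h⟩
      obtain ⟨rfl, rfl⟩ := pair_inj.1 e
      exact h
    · obtain ⟨-, δ, hδ, h⟩ := h
      obtain ⟨h₁, h₂⟩ := hmemF hδ.1 h
      exact pair_mem_prod.2 ⟨hκ.mem_trans h₁ (hS hδ.1), mem_vonNeumann.2 (h₂.trans_le (hrank hδ.1))⟩
  refine ⟨ℓ, ⟨fun p hp => ?_, fun γ A B hA hB => ?_⟩, fun δ hδ => ?_, fun γ A h => ((hℓ _ _).1 h).1⟩
  · obtain ⟨hp, γ, A, rfl, -⟩ := mem_sep.1 hp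
    obtain ⟨h₁, h₂⟩ := pair_mem_prod.1 hp
    exact ⟨γ, A, h₁, mem_vonNeumann.1 h₂, rfl⟩
  · obtain ⟨-, δ, h, hA⟩ := (hℓ _ _).1 hA
    obtain ⟨-, δ', h', hB⟩ := (hℓ _ _).1 hB
    obtain rfl := hNxt h h'
    exact (hF δ h.1).1.2 γ A B hA hB
  · have hδo := hκ.mem (hS hδ)
    let r := ZFSet.sep (fun p => ∃ γ A, γ ∈ δ ∧ p = pair γ A) ℓ
    have hr : RestrictSet ℓ δ r := fun p => mem_sep
    have hPδ : ∀ γ A, γ ∈ δ → P γ A → MemV δ A := by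
      rintro γ A hγ ⟨-, δ', h, hA⟩
      refine (hmemF h.1 hA).2.trans_le ?_
      by_contra hlt
      refine h.2.2 δ hδ hγ ?_
      rcases hδo.mem_trichotomous (hκ.mem (hS h.1)) with h' | h' | h'
      · exact h'
      · exact absurd (h' ▸ le_rfl) hlt
      · exact absurd (rank_lt_of_mem h').le hlt
    refine ⟨r, hr, ⟨fun p hp => ?_, fun γ A B hA hB => ?_⟩, fun θ A hθ hA => ?_⟩
    · obtain ⟨hp, γ, A, hγ, rfl⟩ := mem_sep.1 hp
      exact ⟨γ, A, hγ, hPδ γ A hγ ((hℓ _ _).1 hp), rfl⟩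
    · obtain ⟨-, δ₁, h, hA⟩ := (hℓ _ _).1 (mem_sep.1 hA).1
      obtain ⟨-, δ₂, h', hB⟩ := (hℓ _ _).1 (mem_sep.1 hB).1
      obtain rfl := hNxt h h'
      exact (hF δ₁ h.1).1.2 γ A B hA hB
    · obtain ⟨E, hE⟩ := (hF δ hδ).2 θ A hθ hA
      refine ⟨E, ?_⟩
      obtain ⟨α, hα, hα'⟩ := hbdd δ hδ
      have hαo := hδo.mem hα
      have hagree : ∀ p, p ∈ F δ → ¬ p ∈ r → ∃ γ, (γ ∈ α ∨ γ = α) ∧ ∃ A, p = pair γ A := by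
        intro p hp hpr
        obtain ⟨γ, A, hγ, -, rfl⟩ := (hF δ hδ).1.1 p hp
        refine ⟨γ, ?_, A, rfl⟩
        rcases (hδo.mem hγ).mem_trichotomous hαo with h | h | h
        · exact Or.inl h
        · exact Or.inr h
        · refine absurd (mem_sep.2 ⟨(hℓ _ _).2 ⟨⟨α, h, fun δ' hδ' hlt => ?_⟩, δ, ⟨hδ, hγ, ?_⟩, hp⟩,
            γ, A, hγ, rfl⟩) hpr
          · exact hα' δ' hδ' (hδo.mem_trans hlt hγ)
          · intro δ' hδ' hγδ' hlt
            exact hα' δ' hδ' hlt ((hκ.mem (hS hδ')).mem_trans h hγδ')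
      by_contra hno
      obtain ⟨γ, -, hγ, A', -, e⟩ := (E.transfer ![F δ, r, α] (fun M v => ∀ p, p ∈ v 0 → ¬ p ∈ v 1 →
        ∃ γ, γ ∈ M ∧ (γ ∈ v 2 ∨ γ = v 2) ∧ ∃ A, A ∈ M ∧ p = pair γ A)).1
        (fun p hp hpr => by
          obtain ⟨γ, hγ, A, e⟩ := hagree p hp hpr
          exact ⟨γ, trivial, hγ, A, trivial, e⟩) _ hE hno
      obtain ⟨rfl, -⟩ := pair_inj.1 e
      have hjα : E.e.j α = α := E.crit.2.2 α hαo hα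
      have hγ' : δ ∈ α ∨ δ = α := by simpa [hjα] using hγ
      rcases hγ' with h | rfl
      · exact mem_asymm h hα
      · exact mem_irrefl _ hα

/-- A Laver function at a limit of `S` must be defined at some limits of `S`. -/
theorem not_LDscFun_of_limit {κ S ℓ : ZFSet.{u}} (hS : S ⊆ κ)
    (hlim : ∀ α, α ∈ κ → ∃ δ, δ ∈ S ∧ α ∈ δ)
    (hℓ : ∀ γ A, pair γ A ∈ ℓ → ∃ ξ, ξ ∈ γ ∧ ∀ δ, δ ∈ S → δ ∈ γ → ¬ ξ ∈ δ) : ¬ LDscFun κ ℓ := by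
  intro h
  obtain ⟨θ, hθ, hcard, h0⟩ := exists_isCard {∅} 0
  rw [Ordinal.toZFSet_zero] at h0
  obtain ⟨E, hE⟩ := h.2 θ ∅ hθ
    ⟨{∅}, fun y hy => by rw [mem_singleton.1 hy]; exact empty_subset _, mem_singleton.2 rfl, hcard⟩
  obtain ⟨ξ, hξ, hξ'⟩ := (E.transfer ![ℓ, S] (fun M v => ∀ γ, γ ∈ M → ∀ A, A ∈ M → pair γ A ∈ v 0 →
    ∃ ξ, ξ ∈ γ ∧ ∀ δ, δ ∈ v 1 → δ ∈ γ → ¬ ξ ∈ δ)).1 (fun γ _ A _ => hℓ γ A) κ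
      (E.trans _ (E.e.maps κ trivial) _ E.crit.2.1) ∅ 
      (E.trans _ (E.trans _ (E.e.maps κ trivial) _ E.big) _ h0) hE
  obtain ⟨δ, hδ, hξδ⟩ := hlim ξ hξ
  have hjδ := E.j_mem_j.2 hδ
  rw [E.j_eq_self (hS hδ)] at hjδ
  exact hξ' δ hjδ (hS hδ) hξδ

end LaverDiamond
/-- If `κ` is the least supercompact cardinal that is a limit of supercompact cardinals,
then there is a partial function `ℓ : κ ⇀ V_κ` such that `ℓ↾δ` is a `LD^sc_δ` Laver
function for every supercompact `δ < κ`, but `ℓ` is not a `LD^sc_κ` Laver function. -/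
theorem not_pasted_universal_LDsc (κ : ZFSet.{u})
    (hsc : Supercompact κ)
    (hlim : ∀ α ∈ κ, ∃ δ : ZFSet, δ ∈ κ ∧ α ∈ δ ∧ Supercompact δ)
    (hleast : ∀ κ' ∈ κ, ¬ (Supercompact κ' ∧
      ∀ α ∈ κ', ∃ δ : ZFSet, δ ∈ κ' ∧ α ∈ δ ∧ Supercompact δ)) :
    ∃ ℓ : ZFSet, IsPFun κ ℓ ∧
      (∀ δ : ZFSet, δ ∈ κ → Supercompact δ →
        ∃ r : ZFSet, RestrictSet ℓ δ r ∧ LDscFun δ r) ∧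
      ¬ LDscFun κ ℓ := by
  let S := ZFSet.sep Supercompact κ
  have hS : ∀ δ, δ ∈ S ↔ δ ∈ κ ∧ Supercompact δ := fun δ => ZFSet.mem_sep
  have hF : ∀ δ : ZFSet.{u}, ∃ f, Supercompact δ → LDscFun δ f := fun δ => by
    by_cases h : Supercompact δ
    · exact h.exists_LDscFun.imp fun f hf _ => hf
    · exact ⟨∅, fun h' => absurd h' h⟩
  choose F hF using hF
  obtain ⟨ℓ, hℓ, hres, hdom⟩ := exists_amalgam hsc.isOrdinal (fun δ hδ => ((hS δ).1 hδ).1) F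
    (fun δ hδ => hF δ ((hS δ).1 hδ).2) fun δ hδ => by
      obtain ⟨hδκ, hδ⟩ := (hS δ).1 hδ
      by_contra! hno
      exact hleast δ hδκ ⟨hδ, fun α hα => (hno α hα).imp fun δ' h =>
        ⟨h.2.1, h.2.2, ((hS δ').1 h.1).2⟩⟩
  refine ⟨ℓ, hℓ, fun δ hδ hδs => hres δ ((hS δ).2 ⟨hδ, hδs⟩),
    not_LDscFun_of_limit (fun δ hδ => ((hS δ).1 hδ).1) (fun α hα => ?_) hdom⟩
  obtain ⟨δ, hδ, hαδ, hδs⟩ := hlim α hα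
  exact ⟨δ, (hS δ).2 ⟨hδ, hδs⟩, hαδ⟩
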